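/- arXiv:2410.09483 — 6 statements merged into one kernel-verified Lean document; each statement's English description precedes it below -/
import Mathlib

section
/- Let (R, r) be a dévissage setup. For every R-module M the following are equivalent: (i) M is r-adically complete and r-adically separated and has finite projective (r,μ)-dévissage; (ii) M is finitely presented as an R-module, has finite projective (r,μ)-dévissage, and has bounded r^∞-torsion; (iii) there exist N ≥ 1, a finitely generated projective R-module M∞ of constant rank, and an R-module M_tors killed by r^N having finite projective (r,μ)-dévissage, together with an R-module isomorphism M ≅ M∞ ⊕ M_tors. -/
open Pointwise

universe u

section Core

variable {R : Type u} [CommRing R]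

/-- A dévissage setup: `R` is `r`-torsion-free and `r`-adically complete and separated. -/
structure IsDevissageSetup (R : Type u) [CommRing R] (r : R) : Prop where
  torsionFree : ∀ x : R, r * x = 0 → x = 0
  adicComplete : IsAdicComplete (Ideal.span {r}) R

/-- `Q` has constant rank over `A`: localization at every prime is free of a fixed rank. -/
def ConstRank (A : Type u) [CommRing A] (Q : Type u) [AddCommGroup Q] [Module A Q] : Prop :=
  ∃ c : ℕ, ∀ (p : Ideal A) (_ : p.IsPrime),
    Nonempty ((LocalizedModule p.primeCompl Q) ≃ₗ[Localization.AtPrime p]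
      (Fin c → Localization.AtPrime p))

/-- finitely generated, projective, of constant rank -/
def FinProjConstRank (A : Type u) [CommRing A] (Q : Type u) [AddCommGroup Q] [Module A Q] : Prop :=
  Module.Finite A Q ∧ Module.Projective A Q ∧ ConstRank A Q

/-- the subquotient `rⁿM/rⁿ⁺¹M`, realized as a submodule of `M/rⁿ⁺¹M`. -/
def muQuotSub (r : R) (M : Type u) [AddCommGroup M] [Module R M] (n : ℕ) :
    Submodule R (M ⧸ (r ^ (n + 1) • (⊤ : Submodule R M))) :=
  (r ^ n • (⊤ : Submodule R M)).map (r ^ (n + 1) • (⊤ : Submodule R M)).mkQ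

theorem muQuotSub_isTorsionBySet (r : R) (M : Type u) [AddCommGroup M] [Module R M] (n : ℕ) :
    Module.IsTorsionBySet R (muQuotSub r M n) ((Ideal.span {r} : Ideal R) : Set R) := by
  refine (Module.isTorsionBySet_span_singleton_iff r).mpr ?_
  rintro ⟨x, hx⟩
  obtain ⟨m, hm, rfl⟩ := hx
  obtain ⟨m', -, rfl⟩ := hm
  apply Subtype.ext
  show r • ((r ^ (n + 1) • (⊤ : Submodule R M)).mkQ
      ((DistribMulAction.toLinearMap R M (r ^ n) : M →ₗ[R] M) m')) = 0
  rw [← map_smul]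
  rw [Submodule.mkQ_apply, Submodule.Quotient.mk_eq_zero]
  show r • r ^ n • m' ∈ r ^ (n + 1) • (⊤ : Submodule R M)
  rw [smul_smul, ← pow_succ']
  exact Submodule.smul_mem_pointwise_smul _ _ _ Submodule.mem_top

/-- `M` has finite projective `(r,μ)`-dévissage. -/
def HasFinProjMuDevissage (r : R) (M : Type u) [AddCommGroup M] [Module R M] : Prop :=
  ∀ n : ℕ,
    letI := (muQuotSub_isTorsionBySet r M n).module
    FinProjConstRank (R ⧸ (Ideal.span {r} : Ideal R)) (muQuotSub r M n)

/-- `M` has bounded `r^∞`-torsion. -/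
def BoundedRTorsion (r : R) (M : Type u) [AddCommGroup M] [Module R M] : Prop :=
  ∃ N : ℕ, 1 ≤ N ∧ ∀ x : M, (∃ k : ℕ, r ^ k • x = 0) → r ^ N • x = 0

end Core


open TensorProduct

namespace Dev

/-- elementwise separatedness -/
def Haus {R : Type*} [CommRing R] (r : R) (M : Type*) [AddCommGroup M] [Module R M] : Prop :=
  ∀ x : M, (∀ n : ℕ, ∃ y : M, x = r ^ n • y) → x = 0

/-- elementwise precompleteness -/
def Prec {R : Type*} [CommRing R] (r : R) (M : Type*) [AddCommGroup M] [Module R M] : Prop :=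
  ∀ f g : ℕ → M, (∀ n, f (n + 1) = f n + r ^ n • g n) → ∃ L : M, ∀ n, ∃ y : M, L = f n + r ^ n • y

theorem mem_span_smul {R : Type*} [CommRing R] (r : R) {M : Type*} [AddCommGroup M] [Module R M]
    (n : ℕ) (x : M) : x ∈ (Ideal.span {r} ^ n • ⊤ : Submodule R M) ↔ ∃ y, x = r ^ n • y := by
  rw [Ideal.span_singleton_pow, Submodule.ideal_span_singleton_smul,
    Submodule.mem_smul_pointwise_iff_exists]
  simp [eq_comm]

theorem isAdicComplete_iff' {R : Type*} [CommRing R] (r : R) {M : Type*} [AddCommGroup M]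
    [Module R M] : IsAdicComplete (Ideal.span {r}) M ↔ Haus r M ∧ Prec r M := by
  constructor
  · intro h
    refine ⟨fun x hx => h.toIsHausdorff.haus x fun n => ?_, fun f g hfg => ?_⟩
    · rw [SModEq.zero, mem_span_smul]; exact hx n
    · obtain ⟨L, hL⟩ := h.toIsPrecomplete.prec (f := f) (by
        intro m n hmn
        induction n, hmn using Nat.le_induction with
        | base => rfl
        | succ n hmn ih =>
          refine ih.trans ?_
          rw [SModEq.sub_mem, mem_span_smul, hfg]
          refine ⟨- (r ^ (n - m) • g n), ?_⟩
          rw [smul_neg, smul_smul, ← pow_add, Nat.add_sub_cancel' hmn]; abel)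
      refine ⟨L, fun n => ?_⟩
      have := hL n
      rw [SModEq.sub_mem, mem_span_smul] at this
      obtain ⟨y, hy⟩ := this
      exact ⟨-y, by rw [smul_neg, ← hy]; abel⟩
  · rintro ⟨h1, h2⟩
    have a : IsHausdorff (Ideal.span {r}) M := ⟨fun x hx => h1 x fun n => by
      have := hx n
      rwa [SModEq.zero, mem_span_smul] at this⟩
    have b : IsPrecomplete (Ideal.span {r}) M := ⟨fun f hf => by
      have : ∀ n, ∃ y, f (n + 1) = f n + r ^ n • y := fun n => by
        have := hf (Nat.le_succ n)
        rw [SModEq.sub_mem, mem_span_smul] at this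
        obtain ⟨y, hy⟩ := this
        exact ⟨-y, by rw [smul_neg, ← hy]; abel⟩
      choose g hg using this
      obtain ⟨L, hL⟩ := h2 f g hg
      refine ⟨L, fun n => ?_⟩
      obtain ⟨y, hy⟩ := hL n
      rw [SModEq.sub_mem, mem_span_smul]
      exact ⟨-y, by rw [smul_neg, hy]; abel⟩⟩
    exact { a, b with }

section basics
variable {R : Type*} [CommRing R] {r : R} {M N : Type*} [AddCommGroup M] [Module R M]
  [AddCommGroup N] [Module R N]

theorem Haus.of_inj (h : Haus r N) (f : M →ₗ[R] N) (hf : Function.Injective f) : Haus r M := by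
  intro x hx
  apply hf
  rw [map_zero]
  refine h _ fun n => ?_
  obtain ⟨y, hy⟩ := hx n
  exact ⟨f y, by rw [hy, map_smul]⟩

theorem Prec.of_surj (h : Prec r M) (f : M →ₗ[R] N) (hf : Function.Surjective f) : Prec r N := by
  intro u g hug
  choose g' hg' using fun n => hf (g n)
  obtain ⟨u0, hu0⟩ := hf (u 0)
  let u' : ℕ → M := fun n => Nat.rec u0 (fun n x => x + r ^ n • g' n) n
  have hu' : ∀ n, f (u' n) = u n := by
    intro n
    induction n with
    | zero => exact hu0
    | succ n ih =>
      rw [hug, ← ih, ← hg', ← map_smul, ← map_add]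
  obtain ⟨L, hL⟩ := h u' g' fun n => rfl
  refine ⟨f L, fun n => ?_⟩
  obtain ⟨y, hy⟩ := hL n
  exact ⟨f y, by rw [hy, map_add, map_smul, hu']⟩

theorem Haus.pi {ι : Type*} (h : Haus r M) : Haus r (ι → M) := by
  intro x hx
  ext i
  refine h _ fun n => ?_
  obtain ⟨y, hy⟩ := hx n
  exact ⟨y i, by rw [hy]; rfl⟩

theorem Prec.pi {ι : Type*} (h : Prec r M) : Prec r (ι → M) := by
  intro f g hfg
  have := fun i => h (fun n => f n i) (fun n => g n i) (fun n => by rw [hfg]; rfl)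
  choose L hL using this
  choose y hy using hL
  exact ⟨L, fun n => ⟨fun i => y i n, by ext i; exact hy i n⟩⟩

theorem Haus.prod (h : Haus r M) (h' : Haus r N) : Haus r (M × N) := by
  intro x hx
  refine Prod.ext (h _ fun n => ?_) (h' _ fun n => ?_) <;> obtain ⟨y, hy⟩ := hx n
  · exact ⟨y.1, by rw [hy]; rfl⟩
  · exact ⟨y.2, by rw [hy]; rfl⟩

theorem Prec.prod (h : Prec r M) (h' : Prec r N) : Prec r (M × N) := by
  intro f g hfg
  obtain ⟨L, hL⟩ := h (fun n => (f n).1) (fun n => (g n).1) (fun n => by rw [hfg]; rfl)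
  obtain ⟨L', hL'⟩ := h' (fun n => (f n).2) (fun n => (g n).2) (fun n => by rw [hfg]; rfl)
  refine ⟨(L, L'), fun n => ?_⟩
  obtain ⟨y, hy⟩ := hL n
  obtain ⟨y', hy'⟩ := hL' n
  exact ⟨(y, y'), Prod.ext hy hy'⟩

theorem Prec.of_finite (h : Prec r R) [Module.Finite R M] : Prec r M := by
  obtain ⟨n, f, hf⟩ := Module.Finite.exists_fin' R M
  exact (h.pi).of_surj f hf

theorem Haus.of_proj (h : Haus r R) [Module.Finite R M] [Module.Projective R M] : Haus r M := by
  obtain ⟨n, f, g, hf, hg, hfg⟩ := Module.Finite.exists_comp_eq_id_of_projective R M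
  exact (h.pi).of_inj g hg

theorem torsionFree_of_proj (h : ∀ x : R, r * x = 0 → x = 0) [Module.Finite R M]
    [Module.Projective R M] (x : M) (hx : r • x = 0) : x = 0 := by
  obtain ⟨n, f, g, hf, hg, hfg⟩ := Module.Finite.exists_comp_eq_id_of_projective R M
  apply hg
  rw [map_zero]
  ext i
  apply h
  have := congrFun (congrArg g hx) i
  rwa [map_smul, map_zero] at this

theorem Haus.of_tors {N : ℕ} (h : ∀ x : M, r ^ N • x = 0) : Haus r M := by
  intro x hx
  obtain ⟨y, hy⟩ := hx N
  rw [hy, h]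

theorem Prec.of_tors {N : ℕ} (h : ∀ x : M, r ^ N • x = 0) : Prec r M := by
  intro f g hfg
  have key : ∀ n k, ∃ y, f (n + k) = f n + r ^ n • y := by
    intro n k
    induction k with
    | zero => exact ⟨0, by simp⟩
    | succ k ih =>
      obtain ⟨y, hy⟩ := ih
      exact ⟨y + r ^ k • g (n + k), by
        rw [← add_assoc, hfg, hy, smul_add, smul_smul, ← pow_add, add_assoc]⟩
  refine ⟨f N, fun n => ?_⟩
  rcases le_total n N with hn | hn
  · obtain ⟨y, hy⟩ := key n (N - n)
    rw [Nat.add_sub_cancel' hn] at hy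
    exact ⟨y, hy⟩
  · obtain ⟨y, hy⟩ := key N (n - N)
    rw [Nat.add_sub_cancel' hn, h, add_zero] at hy
    exact ⟨0, by rw [hy]; simp⟩

/-- the key separatedness: f.p. with bounded torsion. -/
theorem Haus.of_fp (hH : Haus r R) (hP : Prec r R) [Module.FinitePresentation R M]
    (N : ℕ) (hN : ∀ x : M, (∃ k : ℕ, r ^ k • x = 0) → r ^ N • x = 0) : Haus r M := by
  obtain ⟨k, f, hf⟩ := Module.Finite.exists_fin' R M
  have hfg := Module.FinitePresentation.fg_ker f hf
  have : Module.Finite R (LinearMap.ker f) := Module.Finite.iff_fg.mpr hfg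
  have hL : Prec r (LinearMap.ker f) := hP.of_finite
  have hFH : Haus r (Fin k → R) := hH.pi
  intro x hx
  obtain ⟨x, rfl⟩ := hf x
  have h1 : ∀ n, ∃ l : LinearMap.ker f, ∃ y, x = l + r ^ (n + N) • y := by
    intro n
    obtain ⟨y, hy⟩ := hx (n + N)
    obtain ⟨y, rfl⟩ := hf y
    exact ⟨⟨x - r ^ (n + N) • y, by simp [hy]⟩, y, by simp⟩
  choose l y hl using h1
  have h2 : ∀ n, ∃ z : LinearMap.ker f, l (n + 1) = l n + r ^ n • z := by
    intro n
    have e : r ^ (n + N) • (y n - r • y (n + 1)) = ((l (n + 1) - l n : LinearMap.ker f) : Fin k → R) := by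
      have e1 := hl n
      rw [hl (n + 1)] at e1
      rw [smul_sub, smul_smul, ← pow_succ, show n + N + 1 = n + 1 + N by ring]
      push_cast
      rw [sub_eq_sub_iff_add_eq_add, add_comm, ← e1]
    have e2 : r ^ N • f (y n - r • y (n + 1)) = 0 := by
      refine hN _ ⟨n + N, ?_⟩
      rw [← map_smul, e]; exact (l (n + 1) - l n).2
    refine ⟨⟨r ^ N • (y n - r • y (n + 1)), by rw [LinearMap.mem_ker, map_smul, e2]⟩, ?_⟩
    apply Subtype.ext
    push_cast
    rw [smul_smul, ← pow_add, e]
    push_cast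
    abel
  choose z hz using h2
  obtain ⟨L, hL⟩ := hL l z hz
  have : x - L = 0 := by
    refine hFH _ fun n => ?_
    obtain ⟨w, hw⟩ := hL n
    refine ⟨r ^ N • y n - w, ?_⟩
    rw [hw]
    conv_lhs => rw [hl n]
    push_cast
    rw [smul_sub, smul_smul, ← pow_add]
    abel
  rw [sub_eq_zero.mp this]
  exact L.2

end basics

/-- idempotent lifting -/
theorem exists_idem {R : Type*} [CommRing R] {r : R} {B : Type*} [Ring B] [Algebra R B]
    (hH : Haus r B) (hP : Prec r B) (a b : B) (h : a * a - a = r • b) :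
    ∃ e c : B, e * e = e ∧ e = a + r • c := by
  let F : B → B := fun x => 3 * (x * x) - 2 * (x * x * x)
  have hF1 : ∀ x, F x - x = (x * x - x) * (1 - 2 * x) := by intro x; simp only [F]; noncomm_ring
  have hF2 : ∀ x, F x * F x - F x = (x * x - x) * (x * x - x) * (4 * (x * x) - 4 * x - 3) := by
    intro x; simp only [F]; noncomm_ring
  let u : ℕ → B := fun n => F^[n] a
  have hu : ∀ n, u (n + 1) = F (u n) := fun n => Function.iterate_succ_apply' F n a
  have hd : ∀ n, ∃ c, u n * u n - u n = r ^ (n + 1) • c := by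
    intro n
    induction n with
    | zero => exact ⟨b, by simpa [u] using h⟩
    | succ n ih =>
      obtain ⟨c, hc⟩ := ih
      refine ⟨r ^ n • (c * c * (4 * (u n * u n) - 4 * u n - 3)), ?_⟩
      rw [hu, hF2, hc, smul_smul, ← pow_add, smul_mul_smul_comm, ← pow_add, smul_mul_assoc]
      congr 2
      ring
  choose c hc using hd
  obtain ⟨L, hL⟩ := hP (fun n => u (n)) (fun n => r • (c n * (1 - 2 * u n))) (by
    intro n
    have := hF1 (u n)
    rw [hc, ← hu, smul_mul_assoc, pow_succ, mul_smul] at this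
    rw [← this]; abel)
  refine ⟨L, ?_⟩
  have hLL : L * L = L := by
    rw [← sub_eq_zero]
    refine hH _ fun n => ?_
    obtain ⟨y, hy⟩ := hL n
    refine ⟨r • c n + (u n * y + y * u n + r ^ n • (y * y) - y), ?_⟩
    have := hc n
    rw [pow_succ, mul_smul] at this
    rw [smul_add, ← this, hy]
    simp only [mul_add, add_mul, smul_add, smul_sub, mul_smul_comm, smul_mul_assoc]
    abel
  obtain ⟨y, hy⟩ := hL 1
  refine ⟨c 0 * (1 - 2 * u 0) + y, hLL, ?_⟩
  have := hF1 (u 0)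
  rw [← hu, hc, zero_add, pow_one] at this
  rw [hy, pow_one, smul_add, ← smul_mul_assoc, ← this]
  simp only [u, Function.iterate_zero, id]
  abel


section rank
variable {A : Type u} [CommRing A] {Q Q' : Type u} [AddCommGroup Q] [Module A Q]
  [AddCommGroup Q'] [Module A Q']

theorem fpcr_iff : FinProjConstRank A Q ↔ Module.Finite A Q ∧ Module.Projective A Q ∧
    ∃ c : ℕ, ∀ p : PrimeSpectrum A, Module.rankAtStalk Q p = c := by
  unfold FinProjConstRank ConstRank
  refine and_congr_right fun h1 => and_congr_right fun h2 => exists_congr fun c => ?_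
  constructor
  · intro h p
    obtain ⟨e⟩ := h p.asIdeal p.isPrime
    rw [Module.rankAtStalk, e.finrank_eq]
    simp
  · intro h p hp
    have hc := h ⟨p, hp⟩
    have : Module.Free (Localization.AtPrime p) (LocalizedModule p.primeCompl Q) :=
      Module.free_of_flat_of_isLocalRing
    rw [Module.rankAtStalk] at hc
    refine ⟨LinearEquiv.ofFinrankEq _ _ ?_⟩
    simpa using hc

theorem fpcr_congr (e : Q ≃ₗ[A] Q') (h : FinProjConstRank A Q) : FinProjConstRank A Q' := by
  rw [fpcr_iff] at h ⊢
  obtain ⟨h1, h2, c, hc⟩ := h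
  exact ⟨Module.Finite.equiv e, Module.Projective.of_equiv e, c, fun p => by
    rw [← Module.rankAtStalk_eq_of_equiv e]; exact hc p⟩

theorem fpcr_prod (h : FinProjConstRank A Q) (h' : FinProjConstRank A Q') :
    FinProjConstRank A (Q × Q') := by
  rw [fpcr_iff] at h h' ⊢
  obtain ⟨h1, h2, c, hc⟩ := h
  obtain ⟨h1', h2', c', hc'⟩ := h'
  exact ⟨inferInstance, inferInstance, c + c', fun p => by
    rw [Module.rankAtStalk_prod, Pi.add_apply, hc, hc']⟩

theorem fpcr_of_prod (h : FinProjConstRank A Q) (h' : FinProjConstRank A (Q × Q')) :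
    FinProjConstRank A Q' := by
  rw [fpcr_iff] at h h' ⊢
  obtain ⟨h1, h2, c, hc⟩ := h
  obtain ⟨h1', h2', c', hc'⟩ := h'
  have f1 : Module.Finite A Q' :=
    Module.Finite.of_surjective (LinearMap.snd A Q Q') LinearMap.snd_surjective
  have f2 : Module.Projective A Q' :=
    Module.Projective.of_split (LinearMap.inr A Q Q') (LinearMap.snd A Q Q')
      (LinearMap.snd_comp_inr ..)
  refine ⟨f1, f2, c' - c, fun p => ?_⟩
  have := hc' p
  rw [Module.rankAtStalk_prod, Pi.add_apply, hc] at this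
  omega

end rank

section tensor
variable {R : Type u} [CommRing R] {r : R} {X Y : Type u} [AddCommGroup X] [Module R X]
  [AddCommGroup Y] [Module R Y]

/-- The reduced ring. -/
abbrev Rbar (r : R) := R ⧸ (Ideal.span {r} : Ideal R)

/-- The reduction map. -/
noncomputable def red (r : R) (X : Type u) [AddCommGroup X] [Module R X] : X →ₗ[R] Rbar r ⊗[R] X :=
  TensorProduct.mk R (Rbar r) X 1

theorem red_surj : Function.Surjective (red r X) := by
  intro t
  obtain ⟨x, hx⟩ := Submodule.mkQ_surjective _ (TensorProduct.quotTensorEquivQuotSMul X (Ideal.span {r}) t)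
  refine ⟨x, ?_⟩
  apply (TensorProduct.quotTensorEquivQuotSMul X (Ideal.span {r})).injective
  rw [← hx]
  exact (TensorProduct.quotTensorEquivQuotSMul_mk_tmul (Ideal.span {r}) 1 x).trans (by simp)

theorem red_eq_zero (x : X) : red r X x = 0 ↔ ∃ y, x = r • y := by
  rw [← (TensorProduct.quotTensorEquivQuotSMul X (Ideal.span {r})).map_eq_zero_iff]
  have : TensorProduct.quotTensorEquivQuotSMul X (Ideal.span {r}) (red r X x) =
    Submodule.Quotient.mk x :=
    (TensorProduct.quotTensorEquivQuotSMul_mk_tmul (Ideal.span {r}) 1 x).trans (by simp)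
  rw [this, Submodule.Quotient.mk_eq_zero]
  simpa using mem_span_smul r 1 x

theorem red_eq (x y : X) : red r X x = red r X y ↔ ∃ z, x = y + r • z := by
  rw [← sub_eq_zero, ← map_sub, red_eq_zero]
  simp only [sub_eq_iff_eq_add']

theorem fpcr_tensor_congr (e : X ≃ₗ[R] Y) (h : FinProjConstRank (Rbar r) (Rbar r ⊗[R] X)) :
    FinProjConstRank (Rbar r) (Rbar r ⊗[R] Y) :=
  fpcr_congr (e.baseChange R (Rbar r) X Y) h

theorem fpcr_baseChange (h : FinProjConstRank R X) :
    FinProjConstRank (Rbar r) (Rbar r ⊗[R] X) := by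
  rw [fpcr_iff] at h ⊢
  obtain ⟨h1, h2, c, hc⟩ := h
  exact ⟨inferInstance, inferInstance, c, fun p => by
    rw [Module.rankAtStalk_baseChange, hc]⟩

theorem mem_pow (n : ℕ) (x : X) : x ∈ (r ^ n • (⊤ : Submodule R X)) ↔ ∃ y, x = r ^ n • y := by
  rw [Submodule.mem_smul_pointwise_iff_exists]
  simp [eq_comm]

/-- two quotients with the same kernel -/
noncomputable def equivOfKer {Z : Type u} [AddCommGroup Z] [Module R Z] (f : Z →ₗ[R] X)
    (g : Z →ₗ[R] Y) (hf : Function.Surjective f) (hg : Function.Surjective g)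
    (h : ∀ z, f z = 0 ↔ g z = 0) : X ≃ₗ[R] Y :=
  (f.quotKerEquivOfSurjective hf).symm ≪≫ₗ
    Submodule.quotEquivOfEq _ _ (by ext z; exact h z) ≪≫ₗ g.quotKerEquivOfSurjective hg

theorem dev_iff : HasFinProjMuDevissage r X ↔ ∀ n : ℕ,
    FinProjConstRank (Rbar r) (Rbar r ⊗[R] (r ^ n • (⊤ : Submodule R X) : Submodule R X)) := by
  unfold HasFinProjMuDevissage
  refine forall_congr' fun n => ?_
  let _ := (muQuotSub_isTorsionBySet r X n).module
  have : IsScalarTower R (Rbar r) (muQuotSub r X n) :=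
    (muQuotSub_isTorsionBySet r X n).isScalarTower
  let f : (r ^ n • (⊤ : Submodule R X) : Submodule R X) →ₗ[R] muQuotSub r X n :=
    (r ^ (n + 1) • (⊤ : Submodule R X)).mkQ.restrict
      (fun x hx => Submodule.mem_map_of_mem hx)
  have hf : Function.Surjective f := by
    rintro ⟨x, y, hy, rfl⟩
    exact ⟨⟨y, hy⟩, rfl⟩
  have hk : ∀ z, f z = 0 ↔ red r _ z = 0 := by
    intro z
    rw [red_eq_zero, ← Subtype.coe_inj]
    change (r ^ (n + 1) • (⊤ : Submodule R X)).mkQ z.1 = 0 ↔ _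
    rw [Submodule.mkQ_apply, Submodule.Quotient.mk_eq_zero, mem_pow]
    constructor
    · rintro ⟨y, hy⟩
      exact ⟨⟨r ^ n • y, (mem_pow _ _).2 ⟨y, rfl⟩⟩, Subtype.ext (by
        rw [hy, pow_succ']; simp [mul_smul])⟩
    · rintro ⟨y, rfl⟩
      obtain ⟨y, hy⟩ := y
      obtain ⟨w, rfl⟩ := (mem_pow _ _).1 hy
      exact ⟨w, by simp [pow_succ', mul_smul]⟩
  let e0 : muQuotSub r X n ≃ₗ[R] _ := equivOfKer f (red r _) hf red_surj hk
  let e : muQuotSub r X n ≃ₗ[Rbar r] _ :=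
    e0.extendScalarsOfSurjective (Ideal.Quotient.mk_surjective)
  exact ⟨fpcr_congr e, fpcr_congr e.symm⟩

theorem dev_congr (e : X ≃ₗ[R] Y) (h : HasFinProjMuDevissage r X) : HasFinProjMuDevissage r Y := by
  rw [dev_iff] at h ⊢
  intro n
  refine fpcr_tensor_congr ?_ (h n)
  refine e.ofSubmodules _ _ ?_
  ext y
  simp only [Submodule.mem_map, mem_pow]
  constructor
  · rintro ⟨x, ⟨z, rfl⟩, rfl⟩
    exact ⟨e z, by simp⟩
  · rintro ⟨z, rfl⟩
    exact ⟨_, ⟨e.symm z, rfl⟩, by simp⟩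

/-- powers in a product -/
noncomputable def powProd (r : R) (X Y : Type u) [AddCommGroup X] [Module R X]
    [AddCommGroup Y] [Module R Y] (n : ℕ) :
    ((r ^ n • (⊤ : Submodule R X) : Submodule R X) × (r ^ n • (⊤ : Submodule R Y) : Submodule R Y))
      ≃ₗ[R] (r ^ n • (⊤ : Submodule R (X × Y)) : Submodule R (X × Y)) :=
  LinearEquiv.ofInjective
    (LinearMap.prodMap (Submodule.subtype (r ^ n • (⊤ : Submodule R X)))
      (Submodule.subtype (r ^ n • (⊤ : Submodule R Y))))
    (Function.Injective.prodMap Subtype.val_injective Subtype.val_injective) ≪≫ₗ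
  LinearEquiv.ofEq _ _ (by
    ext ⟨x, y⟩
    rw [mem_pow, LinearMap.mem_range]
    constructor
    · rintro ⟨⟨⟨a, ha⟩, ⟨b, hb⟩⟩, h⟩
      obtain ⟨a, rfl⟩ := (mem_pow _ _).1 ha
      obtain ⟨b, rfl⟩ := (mem_pow _ _).1 hb
      exact ⟨(a, b), h.symm⟩
    · rintro ⟨⟨a, b⟩, h⟩
      exact ⟨(⟨r ^ n • a, (mem_pow _ _).2 ⟨a, rfl⟩⟩, ⟨r ^ n • b, (mem_pow _ _).2 ⟨b, rfl⟩⟩), h.symm⟩)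

theorem dev_prod (h : HasFinProjMuDevissage r X) (h' : HasFinProjMuDevissage r Y) :
    HasFinProjMuDevissage r (X × Y) := by
  rw [dev_iff] at *
  intro n
  refine fpcr_tensor_congr (powProd r X Y n) ?_
  exact fpcr_congr (TensorProduct.prodRight R (Rbar r) (Rbar r) _ _).symm (fpcr_prod (h n) (h' n))

theorem dev_of_prod (h : HasFinProjMuDevissage r X) (h' : HasFinProjMuDevissage r (X × Y)) :
    HasFinProjMuDevissage r Y := by
  rw [dev_iff] at *
  intro n
  exact fpcr_of_prod (h n) (fpcr_congr (TensorProduct.prodRight R (Rbar r) (Rbar r) _ _)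
    (fpcr_tensor_congr (powProd r X Y n).symm (h' n)))

theorem dev_of_proj (hr : ∀ x : R, r * x = 0 → x = 0) (h : FinProjConstRank R X) :
    HasFinProjMuDevissage r X := by
  have h1 := h.1
  have h2 := h.2.1
  have htf := torsionFree_of_proj (M := X) hr
  have htf' : ∀ n, ∀ x : X, r ^ n • x = 0 → x = 0 := by
    intro n
    induction n with
    | zero => intro x hx; simpa using hx
    | succ n ih => intro x hx; rw [pow_succ', mul_smul] at hx; exact ih _ (htf _ hx)
  rw [dev_iff]
  intro n
  refine fpcr_tensor_congr ?_ (fpcr_baseChange h)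
  refine LinearEquiv.ofInjective (DistribSMul.toLinearMap R X (r ^ n)) ?_ ≪≫ₗ
    LinearEquiv.ofEq _ _ ?_
  · rw [← LinearMap.ker_eq_bot, LinearMap.ker_eq_bot']
    exact htf' n
  · ext x
    rw [mem_pow, LinearMap.mem_range]
    exact exists_congr fun y => eq_comm

theorem fp_of_tors (N : ℕ) : ∀ (X : Type u) [AddCommGroup X] [Module R X],
    (∀ x : X, r ^ N • x = 0) → HasFinProjMuDevissage r X → Module.FinitePresentation R X := by
  induction N with
  | zero =>
    intro X _ _ h _
    have : Subsingleton X := ⟨fun x y => by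
      have hx := h x
      have hy := h y
      simp only [pow_zero, one_smul] at hx hy
      rw [hx, hy]⟩
    infer_instance
  | succ N ih =>
    intro X _ _ h hd
    rw [dev_iff] at hd
    have h0 : FinProjConstRank (Rbar r) (Rbar r ⊗[R] X) := by
      refine fpcr_tensor_congr (LinearEquiv.ofTop _ ?_) (hd 0)
      simp
    have i1 := h0.1
    have i2 := h0.2.1
    have i3 : Module.FinitePresentation (Rbar r) (Rbar r ⊗[R] X) :=
      Module.finitePresentation_of_projective _ _
    have i4 : Module.FinitePresentation R (Rbar r) :=
      Module.finitePresentation_of_surjective (Submodule.mkQ (Ideal.span {r}))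
        (Submodule.mkQ_surjective _) (by rw [Submodule.ker_mkQ]; exact ⟨{r}, by simp⟩)
    have i5 : Module.FinitePresentation R (Rbar r ⊗[R] X) :=
      Module.FinitePresentation.trans R _ (Rbar r)
    have hker : LinearMap.ker (red r X) = r ^ 1 • (⊤ : Submodule R X) := by
      ext x
      rw [LinearMap.mem_ker, red_eq_zero, mem_pow, pow_one]
    have i6 : Module.FinitePresentation R (LinearMap.ker (red r X)) := by
      rw [hker]
      refine ih _ ?_ ?_
      · rintro ⟨x, hx⟩
        obtain ⟨y, rfl⟩ := (mem_pow _ _).1 hx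
        apply Subtype.ext
        simp [smul_smul, ← pow_succ, h]
      · rw [dev_iff]
        intro n
        refine fpcr_tensor_congr ?_ (hd (n + 1))
        refine LinearEquiv.ofEq _ _ ?_ ≪≫ₗ (Submodule.equivSubtypeMap (r ^ 1 • (⊤ : Submodule R X))
          (r ^ n • ⊤)).symm
        ext x
        simp only [Submodule.mem_map, mem_pow]
        constructor
        · rintro ⟨y, rfl⟩
          exact ⟨_, ⟨⟨r ^ 1 • y, (mem_pow _ _).2 ⟨y, rfl⟩⟩, rfl⟩, by simp [pow_succ, mul_smul]⟩
        · rintro ⟨_, ⟨⟨y, hy⟩, rfl⟩, rfl⟩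
          obtain ⟨y, rfl⟩ := (mem_pow _ _).1 hy
          exact ⟨y, by simp [pow_succ, mul_smul]⟩
    exact Module.finitePresentation_of_ker (red r X) red_surj

theorem r_mem_jac (h : IsAdicComplete (Ideal.span {r}) R) (m : Ideal R) [hm : m.IsMaximal] :
    Ideal.span {r} ≤ m :=
  (IsAdicComplete.le_jacobson_bot (Ideal.span {r})).trans
    ((Ideal.jacobson_mono bot_le).trans Ideal.jacobson_eq_self_of_isMaximal.le)

end tensor

section lift
variable {R : Type u} [CommRing R] {r : R} {X : Type u} [AddCommGroup X] [Module R X]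

theorem surj_of_mod {P : Type*} [AddCommGroup P] [Module R P] (hP : Prec r P) (hX : Haus r X)
    (f : P →ₗ[R] X) (h : ∀ x, ∃ p z, x = f p + r • z) : Function.Surjective f := by
  choose p z hpz using h
  intro x
  let zs : ℕ → X := fun n => z^[n] x
  have hzs : ∀ n, zs (n + 1) = z (zs n) := fun n => Function.iterate_succ_apply' z n x
  let us : ℕ → P := fun n => Nat.rec 0 (fun n w => w + r ^ n • p (zs n)) n
  have hus : ∀ n, us (n + 1) = us n + r ^ n • p (zs n) := fun n => rfl
  have key : ∀ n, x = f (us n) + r ^ n • zs n := by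
    intro n
    induction n with
    | zero => simp [us, zs]
    | succ n ih =>
      rw [hus, hzs, map_add, map_smul, pow_succ, mul_smul, add_assoc, ← smul_add, ← hpz]
      exact ih
  obtain ⟨L, hL⟩ := hP us _ hus
  refine ⟨L, ?_⟩
  rw [eq_comm, ← sub_eq_zero]
  refine hX _ fun n => ?_
  obtain ⟨y, hy⟩ := hL n
  refine ⟨zs n - f y, ?_⟩
  rw [smul_sub, ← map_smul]
  nth_rw 1 [key n]
  rw [hy, map_add]
  abel

theorem exists_end {k : ℕ} {Y Z : Type*} [AddCommGroup Y] [Module R Y] [AddCommGroup Z] [Module R Z]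
    (q : Y →ₗ[R] Z) (hq : Function.Surjective q) (g : (Fin k → R) →ₗ[R] Z) :
    ∃ a : (Fin k → R) →ₗ[R] Y, ∀ v, q (a v) = g v := by
  obtain ⟨a, ha⟩ := Module.projective_lifting_property q g hq
  exact ⟨a, fun v => by rw [← ha]; rfl⟩

theorem finProj_of_red (hRH : Haus r R) (hRP : Prec r R) (hX : Haus r X)
    (htf : ∀ x : X, r • x = 0 → x = 0)
    (h1 : Module.Finite (Rbar r) (Rbar r ⊗[R] X))
    (h2 : Module.Projective (Rbar r) (Rbar r ⊗[R] X)) :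
    Module.Finite R X ∧ Module.Projective R X := by
  obtain ⟨k, π, s, hπ, hs, hπs⟩ :=
    Module.Finite.exists_comp_eq_id_of_projective (Rbar r) (Rbar r ⊗[R] X)
  replace hπs : ∀ t, π (s t) = t := fun t => LinearMap.congr_fun hπs t
  let q : (Fin k → R) →ₗ[R] (Fin k → Rbar r) := (Submodule.mkQ (Ideal.span {r})).compLeft (Fin k)
  have hq : Function.Surjective q := by
    intro v
    choose w hw using fun i => Submodule.mkQ_surjective (Ideal.span {r}) (v i)
    exact ⟨w, funext hw⟩
  have hq0 : ∀ v, q v = 0 ↔ ∃ w, v = r • w := by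
    intro v
    constructor
    · intro h
      have : ∀ i, ∃ w, v i = r * w := by
        intro i
        have := congrFun h i
        change Submodule.Quotient.mk (v i) = 0 at this
        rw [Submodule.Quotient.mk_eq_zero, Ideal.mem_span_singleton] at this
        exact this
      choose w hw using this
      exact ⟨w, funext hw⟩
    · rintro ⟨w, rfl⟩
      ext i
      change Submodule.Quotient.mk (r * w i) = 0
      rw [Submodule.Quotient.mk_eq_zero]
      exact Ideal.mul_mem_right _ _ (Ideal.mem_span_singleton_self r)
  obtain ⟨φ, hφ⟩ := exists_end (red r X) red_surj (π.restrictScalars R ∘ₗ q)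
  replace hφ : ∀ v, red r X (φ v) = π (q v) := hφ
  obtain ⟨a, ha⟩ := exists_end q hq
    (s.restrictScalars R ∘ₗ π.restrictScalars R ∘ₗ q)
  replace ha : ∀ v, q (a v) = s (π (q v)) := ha
  have hb : ∃ b : Module.End R (Fin k → R), (a : Module.End R (Fin k → R)) * a - a = r • b := by
    have hz : ∀ v, ∃ w, a (a v) - a v = r • w := by
      intro v
      rw [← hq0, map_sub, ha, ha, hπs, sub_self]
    have := fun i => hz (Pi.single i 1)
    choose w hw using this
    refine ⟨Fintype.linearCombination R w, ?_⟩
    refine LinearMap.pi_ext' fun i => LinearMap.ext_ring ?_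
    simpa using hw i
  obtain ⟨b, hb⟩ := hb
  have hBH : Haus r (Module.End R (Fin k → R)) := by
    have : Haus r (Matrix (Fin k) (Fin k) R) := hRH.pi.pi
    exact this.of_inj (LinearMap.toMatrix' (R := R)).toLinearMap LinearMap.toMatrix'.injective
  have hBP : Prec r (Module.End R (Fin k → R)) := by
    have : Prec r (Matrix (Fin k) (Fin k) R) := hRP.pi.pi
    exact this.of_surj (LinearMap.toMatrix' (R := R)).symm.toLinearMap
      LinearMap.toMatrix'.symm.surjective
  obtain ⟨e, c, hee, hec⟩ := exists_idem hBH hBP a b hb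
  have hee' : ∀ v, e (e v) = e v := fun v => LinearMap.congr_fun hee v
  have hqe : ∀ v, q (e v) = s (π (q v)) := by
    intro v
    rw [hec, LinearMap.add_apply, map_add, ha, LinearMap.smul_apply, (hq0 _).2 ⟨_, rfl⟩, add_zero]
  let P := LinearMap.range e
  have i1 : Module.Projective R P := by
    refine Module.Projective.of_split P.subtype e.rangeRestrict ?_
    ext ⟨v, w, rfl⟩ : 2
    simp [hee']
  have i2 : Module.Finite R P := inferInstance
  let ψ : P →ₗ[R] X := φ ∘ₗ P.subtype
  have hsurj : Function.Surjective ψ := by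
    refine surj_of_mod (hRP.of_finite) hX ψ fun x => ?_
    obtain ⟨v, hv⟩ := hπ (red r X x)
    obtain ⟨v, rfl⟩ := hq v
    obtain ⟨z, hz⟩ := (red_eq x (φ (e v))).1 (by rw [hφ, hqe, hπs, hv])
    exact ⟨⟨e v, v, rfl⟩, z, hz⟩
  have hinj : Function.Injective ψ := by
    rw [← LinearMap.ker_eq_bot, LinearMap.ker_eq_bot']
    have step : ∀ v, φ (e v) = 0 → ∃ w, e v = r • e w ∧ φ (e w) = 0 := by
      intro v hv
      have h3 : π (q (e v)) = 0 := by rw [← hφ, hv, map_zero]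
      have h4 : q (e v) = 0 := by
        rw [← hee', hqe, h3, map_zero]
      obtain ⟨w, hw⟩ := (hq0 _).1 h4
      have h5 : e v = r • e w := by rw [← hee', hw, map_smul]
      refine ⟨w, h5, htf _ ?_⟩
      rw [← map_smul, ← h5, hv]
    have steps : ∀ n v, φ (e v) = 0 → ∃ w, e v = r ^ n • e w ∧ φ (e w) = 0 := by
      intro n
      induction n with
      | zero => intro v hv; exact ⟨v, by simp, hv⟩
      | succ n ih =>
        intro v hv
        obtain ⟨w, hw, hw'⟩ := ih v hv
        obtain ⟨y, hy, hy'⟩ := step w hw'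
        exact ⟨y, by rw [hw, hy, smul_smul, pow_succ], hy'⟩
    rintro ⟨_, v, rfl⟩ hv
    apply Subtype.ext
    refine hRH.pi _ fun n => ?_
    obtain ⟨w, hw, -⟩ := steps n v hv
    exact ⟨e w, hw⟩
  let E : P ≃ₗ[R] X := LinearEquiv.ofBijective ψ ⟨hinj, hsurj⟩
  exact ⟨Module.Finite.equiv E, Module.Projective.of_equiv E⟩

theorem fpcr_of_red (hR : IsAdicComplete (Ideal.span {r}) R) (hX : Haus r X)
    (htf : ∀ x : X, r • x = 0 → x = 0)
    (h : FinProjConstRank (Rbar r) (Rbar r ⊗[R] X)) : FinProjConstRank R X := by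
  obtain ⟨hRH, hRP⟩ := (isAdicComplete_iff' r).1 hR
  rw [fpcr_iff] at h ⊢
  obtain ⟨h1, h2, c, hc⟩ := h
  obtain ⟨h3, h4⟩ := finProj_of_red hRH hRP hX htf h1 h2
  refine ⟨h3, h4, c, fun p => ?_⟩
  obtain ⟨m, hm, hpm⟩ := Ideal.exists_le_maximal p.asIdeal p.isPrime.ne_top
  have hm' := hm.isPrime
  have hrm := r_mem_jac hR m
  rw [Module.rankAtStalk_eq_of_le_of_finite_of_flat X (q := ⟨m, hm'⟩) hpm]
  have : (⟨m, hm'⟩ : PrimeSpectrum R) ∈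
      Set.range (PrimeSpectrum.comap (algebraMap R (Rbar r))) := by
    rw [Ideal.Quotient.algebraMap_eq, range_comap_of_surjective _ _ Ideal.Quotient.mk_surjective]
    simpa [PrimeSpectrum.mem_zeroLocus] using hrm
  obtain ⟨p', hp'⟩ := this
  rw [← hp', ← Module.rankAtStalk_baseChange, hc]

theorem rank_le_of_surj {A : Type u} [CommRing A] {Q Q' : Type u} [AddCommGroup Q] [Module A Q]
    [AddCommGroup Q'] [Module A Q'] [Module.Finite A Q] (f : Q →ₗ[A] Q')
    (hf : Function.Surjective f) (p : PrimeSpectrum A) :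
    Module.rankAtStalk Q' p ≤ Module.rankAtStalk Q p :=
  LinearMap.finrank_le_finrank_of_surjective
    (f := LocalizedModule.map p.asIdeal.primeCompl f) (LocalizedModule.map_surjective _ f hf)

/-- multiplication by `r` -/
noncomputable def mulr (r : R) (X : Type u) [AddCommGroup X] [Module R X] (n : ℕ) :
    (r ^ n • (⊤ : Submodule R X) : Submodule R X) →ₗ[R]
      (r ^ (n + 1) • (⊤ : Submodule R X) : Submodule R X) :=
  (DistribSMul.toLinearMap R X r).restrict (fun x hx => by
    obtain ⟨y, rfl⟩ := (mem_pow _ _).1 hx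
    exact (mem_pow _ _).2 ⟨y, by
      change r • r ^ n • y = _
      rw [smul_smul, pow_succ']⟩)

theorem mulr_surj (n : ℕ) : Function.Surjective (mulr r X n) := by
  rintro ⟨x, hx⟩
  obtain ⟨y, rfl⟩ := (mem_pow _ _).1 hx
  exact ⟨⟨r ^ n • y, (mem_pow _ _).2 ⟨y, rfl⟩⟩, Subtype.ext (by
    change r • r ^ n • y = r ^ (n + 1) • y
    rw [smul_smul, pow_succ'])⟩

theorem stab (h : HasFinProjMuDevissage r X) : ∃ N : ℕ, 1 ≤ N ∧ ∀ n, N ≤ n → ∀ x : X,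
    r ^ (n + 1) • x = 0 → ∃ z, r ^ n • x = r ^ (n + 1) • z := by
  rw [dev_iff] at h
  have h' := fun n => fpcr_iff.1 (h n)
  choose i1 i2 c hc using h'
  let f := fun n => (mulr r X n).baseChange (Rbar r)
  have hf : ∀ n, Function.Surjective (f n) := fun n =>
    LinearMap.lTensor_surjective _ (mulr_surj n)
  have : ∃ N : ℕ, 1 ≤ N ∧ ∀ n, N ≤ n → Function.Bijective (f n) := by
    by_cases hA : Nonempty (PrimeSpectrum (Rbar r))
    · obtain ⟨p⟩ := hA
      have hanti : Antitone c := antitone_nat_of_succ_le fun n => by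
        rw [← hc n p, ← hc (n + 1) p]
        exact rank_le_of_surj (f n) (hf n) p
      refine ⟨max 1 (Function.argmin c), le_max_left _ _, fun n hn => ?_⟩
      refine Module.bijective_of_surjective_of_rankAtStalk_eq (hf n) fun m _ => ?_
      rw [hc, hc]
      refine le_antisymm ?_ (hanti (Nat.le_succ n))
      exact (hanti ((le_max_right _ _).trans hn)).trans (Function.argmin_le c (n + 1))
    · refine ⟨1, le_rfl, fun n _ =>
        Module.bijective_of_surjective_of_rankAtStalk_eq (hf n) fun m hm => ?_⟩
      exact (hA ⟨⟨m, hm.isPrime⟩⟩).elim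
  obtain ⟨N, hN, hb⟩ := this
  refine ⟨N, hN, fun n hn x hx => ?_⟩
  let y : (r ^ n • (⊤ : Submodule R X) : Submodule R X) :=
    ⟨r ^ n • x, (mem_pow _ _).2 ⟨x, rfl⟩⟩
  have h0 : mulr r X n y = 0 := Subtype.ext (by
    change r • r ^ n • x = 0
    rw [smul_smul, ← pow_succ', hx])
  have h1 : f n (red r _ y) = 0 := by
    simp only [f, red, TensorProduct.mk_apply, LinearMap.baseChange_tmul, h0, tmul_zero]
  have h2 : red r _ y = 0 := (hb n hn).1 (by rw [h1, map_zero])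
  obtain ⟨⟨w, hw⟩, hyw⟩ := (red_eq_zero _).1 h2
  obtain ⟨w, rfl⟩ := (mem_pow _ _).1 hw
  refine ⟨w, ?_⟩
  have := congrArg Subtype.val hyw
  simpa [y, pow_succ', mul_smul] using this

theorem one_three (hR : IsDevissageSetup R r) (hX : Haus r X) (h : HasFinProjMuDevissage r X) :
    ∃ N : ℕ, 1 ≤ N ∧
        ∃ (Minf : Type u) (_ : AddCommGroup Minf) (_ : Module R Minf)
          (Mt : Type u) (_ : AddCommGroup Mt) (_ : Module R Mt),
          FinProjConstRank R Minf ∧ (∀ x : Mt, r ^ N • x = 0) ∧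
          HasFinProjMuDevissage r Mt ∧ Nonempty (X ≃ₗ[R] Minf × Mt) := by
  obtain ⟨N, hN, hst⟩ := stab h
  let Y : Submodule R X := r ^ N • ⊤
  have hY : Haus r Y := hX.of_inj Y.subtype Subtype.val_injective
  have htf : ∀ y : Y, r • y = 0 → y = 0 := by
    rintro ⟨x, hx⟩ hrx
    obtain ⟨x, rfl⟩ := (mem_pow _ _).1 hx
    replace hrx : r ^ (N + 1) • x = 0 := by
      have := congrArg Subtype.val hrx
      simpa [pow_succ', mul_smul] using this
    apply Subtype.ext
    have key : ∀ k, ∃ z, r ^ N • x = r ^ (N + k) • z := by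
      intro k
      induction k with
      | zero => exact ⟨x, rfl⟩
      | succ k ih =>
        obtain ⟨z, hz⟩ := ih
        obtain ⟨w, hw⟩ := hst (N + k) (by omega) z (by
          rw [pow_succ', mul_smul, ← hz, smul_smul, ← pow_succ', hrx])
        exact ⟨w, by rw [hz, hw]; rfl⟩
    refine hX _ fun n => ?_
    obtain ⟨z, hz⟩ := key n
    exact ⟨r ^ N • z, by rw [smul_smul, ← pow_add, add_comm n, ← hz]⟩
  have hfp : FinProjConstRank R Y := fpcr_of_red hR.adicComplete hY htf (dev_iff.1 h N)
  have i1 := hfp.2.1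
  let f : X →ₗ[R] Y := (DistribSMul.toLinearMap R X (r ^ N)).codRestrict Y
    (fun x => (mem_pow _ _).2 ⟨x, rfl⟩)
  have hf : Function.Surjective f := by
    rintro ⟨y, hy⟩
    obtain ⟨x, rfl⟩ := (mem_pow _ _).1 hy
    exact ⟨x, rfl⟩
  obtain ⟨s, hs⟩ := Module.projective_lifting_property f LinearMap.id hf
  replace hs : ∀ y, f (s y) = y := fun y => LinearMap.congr_fun hs y
  let g : (Y × LinearMap.ker f) →ₗ[R] X := s.coprod (LinearMap.ker f).subtype
  have hg : Function.Bijective g := by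
    constructor
    · rw [← LinearMap.ker_eq_bot, LinearMap.ker_eq_bot']
      rintro ⟨y, k, hk⟩ h0
      have h1 : s y + k = 0 := h0
      have h2 : f (s y + k) = 0 := by rw [h1, map_zero]
      rw [map_add, hs, LinearMap.mem_ker.1 hk, add_zero] at h2
      subst h2
      rw [map_zero, zero_add] at h1
      subst h1
      rfl
    · intro x
      exact ⟨(f x, ⟨x - s (f x), by rw [LinearMap.mem_ker, map_sub, hs, sub_self]⟩), by simp [g]⟩
  let e := (LinearEquiv.ofBijective g hg).symm
  refine ⟨N, hN, Y, inferInstance, inferInstance, LinearMap.ker f, inferInstance, inferInstance,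
    hfp, ?_, dev_of_prod (dev_of_proj hR.torsionFree hfp) (dev_congr e h), ⟨e⟩⟩
  rintro ⟨x, hx⟩
  have h0 : r ^ N • x = 0 := congrArg Subtype.val (LinearMap.mem_ker.1 hx)
  exact Subtype.ext h0

end lift

end Dev
/-- Theorem `complet_pf_1`: for a dévissage setup `(R,r)` and any `R`-module `M`,
the conditions (i) complete+separated with finite projective `(r,μ)`-dévissage,
(ii) finitely presented with finite projective `(r,μ)`-dévissage and bounded `r^∞`-torsion,
(iii) decomposition as a finite projective constant-rank module plus an `r^N`-torsion module
with finite projective `(r,μ)`-dévissage, are equivalent. -/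
theorem devissage_structure_tfae {R : Type u} [CommRing R] (r : R)
    (hR : IsDevissageSetup R r) (M : Type u) [AddCommGroup M] [Module R M] :
    ((IsAdicComplete (Ideal.span {r}) M ∧ HasFinProjMuDevissage r M) ↔
      (Module.FinitePresentation R M ∧ HasFinProjMuDevissage r M ∧ BoundedRTorsion r M)) ∧
    ((Module.FinitePresentation R M ∧ HasFinProjMuDevissage r M ∧ BoundedRTorsion r M) ↔
      (∃ N : ℕ, 1 ≤ N ∧
        ∃ (Minf : Type u) (_ : AddCommGroup Minf) (_ : Module R Minf)
          (Mt : Type u) (_ : AddCommGroup Mt) (_ : Module R Mt),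
          FinProjConstRank R Minf ∧ (∀ x : Mt, r ^ N • x = 0) ∧
          HasFinProjMuDevissage r Mt ∧ Nonempty (M ≃ₗ[R] Minf × Mt))) := by
  have hRc := (Dev.isAdicComplete_iff' r).1 hR.adicComplete
  have h21 : (Module.FinitePresentation R M ∧ HasFinProjMuDevissage r M ∧ BoundedRTorsion r M) →
      (IsAdicComplete (Ideal.span {r}) M ∧ HasFinProjMuDevissage r M) := by
    rintro ⟨h1, h2, N, -, h3⟩
    exact ⟨(Dev.isAdicComplete_iff' r).2 ⟨Dev.Haus.of_fp hRc.1 hRc.2 N h3, hRc.2.of_finite⟩, h2⟩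
  have h32 : (∃ N : ℕ, 1 ≤ N ∧
        ∃ (Minf : Type u) (_ : AddCommGroup Minf) (_ : Module R Minf)
          (Mt : Type u) (_ : AddCommGroup Mt) (_ : Module R Mt),
          FinProjConstRank R Minf ∧ (∀ x : Mt, r ^ N • x = 0) ∧
          HasFinProjMuDevissage r Mt ∧ Nonempty (M ≃ₗ[R] Minf × Mt)) →
      (Module.FinitePresentation R M ∧ HasFinProjMuDevissage r M ∧ BoundedRTorsion r M) := by
    rintro ⟨N, hN, P, _, _, T, _, _, hP, hT, hdT, ⟨e⟩⟩
    have i1 := hP.1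
    have i2 := hP.2.1
    have i3 : Module.FinitePresentation R P := Module.finitePresentation_of_projective _ _
    have i4 : Module.FinitePresentation R T := Dev.fp_of_tors N T hT hdT
    refine ⟨Module.FinitePresentation.of_equiv e.symm,
      Dev.dev_congr e.symm (Dev.dev_prod (Dev.dev_of_proj hR.torsionFree hP) hdT), N, hN, ?_⟩
    rintro x ⟨k, hk⟩
    apply e.injective
    have hk' : r ^ k • (e x).1 = 0 := by
      have := congrArg (fun y => (e y).1) hk
      simpa using this
    have h0 : (e x).1 = 0 := by
      have : ∀ k, ∀ y : P, r ^ k • y = 0 → y = 0 := by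
        intro k
        induction k with
        | zero => intro y hy; simpa using hy
        | succ k ih =>
          intro y hy
          rw [pow_succ', mul_smul] at hy
          exact ih _ (Dev.torsionFree_of_proj hR.torsionFree _ hy)
      exact this k _ hk'
    rw [map_smul, map_zero]
    exact Prod.ext (by rw [Prod.smul_fst, h0, smul_zero]; rfl) (hT _)
  have h13 := fun h : IsAdicComplete (Ideal.span {r}) M ∧ HasFinProjMuDevissage r M =>
    Dev.one_three hR ((Dev.isAdicComplete_iff' r).1 h.1).1 h.2
  exact ⟨⟨fun h => h32 (h13 h), h21⟩, ⟨fun h => h13 (h21 h), h32⟩⟩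
end

section
/- Let (R, r) be a dévissage setup and let M be a finitely presented R-module with finite projective (r,μ)-dévissage and bounded r^∞-torsion. Then for every r-torsion-free R-module P (i.e. r·x = 0 implies x = 0 in P), the group Tor₁^R(M, P) vanishes. -/
open Pointwise

universe u

section A
variable {R : Type u} [CommRing R] {r : R}

theorem aux_dvd_zero (h : IsAdicComplete (Ideal.span {r}) R) (x : R) (hx : ∀ n : ℕ, r ^ n ∣ x) :
    x = 0 := by
  apply h.toIsHausdorff.haus'
  intro n
  rw [SModEq.zero, Ideal.span_singleton_pow, smul_eq_mul, Ideal.mul_top,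
    Ideal.mem_span_singleton]
  exact hx n

theorem aux_lift_matrix (h : IsAdicComplete (Ideal.span {r}) R) {k : ℕ}
    (E D : Matrix (Fin k) (Fin k) R) (hE : E * E - E = r • D) :
    ∃ E' D' : Matrix (Fin k) (Fin k) R, E' * E' = E' ∧ E' - E = r • D' := by
  have step : ∀ (n : ℕ) (e d : Matrix (Fin k) (Fin k) R), e * e - e = r ^ (n + 1) • d →
      ∃ e' d' c, e' * e' - e' = r ^ (n + 2) • d' ∧ e' - e = r ^ (n + 1) • c := by
    intro n e d hed
    refine ⟨3 * e * e - 2 * e * e * e, r ^ n • (d * d * (4 * e * e - 4 * e - 3)), d * (1 - 2 * e),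
      ?_, ?_⟩
    · have : (3 * e * e - 2 * e * e * e) * (3 * e * e - 2 * e * e * e)
          - (3 * e * e - 2 * e * e * e)
          = (e * e - e) * (e * e - e) * (4 * e * e - 4 * e - 3) := by noncomm_ring
      rw [this, hed, smul_mul_smul_comm, smul_mul_assoc, smul_smul]
      congr 1; ring
    · have : 3 * e * e - 2 * e * e * e - e = (e * e - e) * (1 - 2 * e) := by noncomm_ring
      rw [this, hed, smul_mul_assoc]
  choose! f g c hf hc using step
  let s : ℕ → Matrix (Fin k) (Fin k) R × Matrix (Fin k) (Fin k) R :=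
    fun n => Nat.rec (E, D) (fun n p => (f n p.1 p.2, g n p.1 p.2)) n
  have hs : ∀ n, (s n).1 * (s n).1 - (s n).1 = r ^ (n + 1) • (s n).2 := by
    intro n
    induction n with
    | zero => simpa [s] using hE
    | succ n ih => exact hf n _ _ ih
  have hc' : ∀ n, (s (n+1)).1 - (s n).1 = r ^ (n + 1) • c n (s n).1 (s n).2 :=
    fun n => hc n _ _ (hs n)
  have hcauchy : ∀ m n i j, m ≤ n → r ^ m ∣ (s n).1 i j - (s m).1 i j := by
    intro m n i j hmn
    induction n, hmn using Nat.le_induction with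
    | base => simp
    | succ n hmn ih =>
      have h1 := congrFun (congrFun (hc' n) i) j
      simp only [Matrix.sub_apply, Matrix.smul_apply, smul_eq_mul] at h1
      have h2 : r ^ m ∣ (s (n+1)).1 i j - (s n).1 i j := by
        rw [h1]; exact (pow_dvd_pow r (by omega)).mul_right _
      have := dvd_add h2 ih
      simpa using this
  have hlim : ∀ i j, ∃ L : R, ∀ n, r ^ n ∣ L - (s n).1 i j := by
    intro i j
    obtain ⟨L, hL⟩ := h.toIsPrecomplete.prec' (fun n => (s n).1 i j) (by
      intro m n hmn
      rw [SModEq.comm, SModEq.sub_mem, Ideal.span_singleton_pow, smul_eq_mul, Ideal.mul_top,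
        Ideal.mem_span_singleton]
      exact hcauchy m n i j hmn)
    refine ⟨L, fun n => ?_⟩
    have := (hL n).symm
    rw [SModEq.sub_mem, Ideal.span_singleton_pow, smul_eq_mul, Ideal.mul_top,
        Ideal.mem_span_singleton] at this
    exact this
  choose L hL using hlim
  choose X hX using hL
  have hLX : ∀ n, (Matrix.of L) - (s n).1 = r ^ n • Matrix.of (fun i j => X i j n) := by
    intro n; ext i j; simp [hX]
  refine ⟨Matrix.of L, Matrix.of (fun i j => X i j 1) + c 0 (s 0).1 (s 0).2, ?_, ?_⟩
  · rw [← sub_eq_zero]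
    ext i j
    apply aux_dvd_zero h
    intro n
    have h1 : Matrix.of L = (s n).1 + r ^ n • Matrix.of (fun i j => X i j n) := by
      rw [← hLX n]; abel
    generalize Matrix.of (fun i j => X i j n) = Y at h1
    have h2 : Matrix.of L * Matrix.of L - Matrix.of L =
        r ^ n • (r • (s n).2 + Y * (s n).1 + (s n).1 * Y + r ^ n • (Y * Y) - Y) := by
      rw [h1]
      have := hs n
      rw [sub_eq_iff_eq_add] at this
      simp only [add_mul, mul_add, this, smul_mul_assoc, mul_smul_comm, smul_add, smul_sub,
        smul_smul, ← pow_succ]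
      abel
    rw [h2]
    simp only [Matrix.smul_apply, smul_eq_mul]
    exact dvd_mul_right _ _
  · have h1 := hLX 1
    have h2 := hc' 0
    rw [pow_one] at h1
    rw [zero_add, pow_one] at h2
    rw [smul_add, ← h1, ← h2]
    simp [s]

theorem aux_lift_end (h : IsAdicComplete (Ideal.span {r}) R) {k : ℕ}
    (E D : Module.End R (Fin k → R)) (hE : E * E - E = r • D) :
    ∃ E' D' : Module.End R (Fin k → R), E' * E' = E' ∧ E' - E = r • D' := by
  let e := Matrix.toLinAlgEquiv' (R := R) (n := Fin k)
  obtain ⟨E', D', h1, h2⟩ := aux_lift_matrix h (e.symm E) (e.symm D) (by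
    rw [← map_mul, ← map_sub, hE, map_smul])
  refine ⟨e E', e D', by rw [← map_mul, h1], ?_⟩
  rw [← map_smul, ← h2, map_sub]; simp

theorem aux_projective (h : IsAdicComplete (Ideal.span {r}) R)
    (htf : ∀ x : R, r * x = 0 → x = 0)
    {L Q : Type u} [AddCommGroup L] [Module R L] [AddCommGroup Q] [Module R Q]
    [Module (R ⧸ (Ideal.span {r} : Ideal R)) Q]
    [IsScalarTower R (R ⧸ (Ideal.span {r} : Ideal R)) Q]
    [Module.Finite R L] (hL : ∀ x : L, r • x = 0 → x = 0)
    [Module.Projective (R ⧸ (Ideal.span {r} : Ideal R)) Q]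
    (g : L →ₗ[R] Q) (hg : Function.Surjective g) (hker : ∀ x, g x = 0 → ∃ y, x = r • y) :
    Module.Projective R L := by
  obtain ⟨k, φ, hφ⟩ := Module.Finite.exists_fin' R L
  set A := R ⧸ (Ideal.span {r} : Ideal R) with hA
  have hmk : ∀ x : R, (algebraMap R A x = 0) ↔ r ∣ x := by
    intro x
    rw [← Ideal.mem_span_singleton]
    exact Ideal.Quotient.eq_zero_iff_mem
  have hrQ : ∀ q : Q, r • q = 0 := by
    intro q
    rw [← algebraMap_smul A r q, (hmk r).2 dvd_rfl, zero_smul]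
  let ψ : (Fin k → A) →ₗ[A] Q :=
    Fintype.linearCombination A (fun i => g (φ (Pi.single i 1)))
  let mk : (Fin k → R) →ₗ[R] (Fin k → A) := (Algebra.linearMap R A).compLeft (Fin k)
  have hmk_apply : ∀ x i, mk x i = algebraMap R A (x i) := fun x i => rfl
  have hψ : ∀ x, ψ (mk x) = g (φ x) := by
    intro x
    have hx : x = ∑ i, x i • (Pi.single i (1:R) : Fin k → R) := by
      exact pi_eq_sum_univ' x
    conv_rhs => rw [hx]
    simp [ψ, Fintype.linearCombination_apply, hmk_apply]
  have hψs : Function.Surjective ψ := by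
    intro q
    obtain ⟨l, rfl⟩ := hg q
    obtain ⟨x, rfl⟩ := hφ l
    exact ⟨mk x, hψ x⟩
  obtain ⟨s, hs⟩ := Module.projective_lifting_property ψ LinearMap.id hψs
  have hs' : ∀ q, ψ (s q) = q := fun q => LinearMap.congr_fun hs q
  have hmks : Function.Surjective mk := by
    intro y
    have : ∀ i, ∃ x : R, algebraMap R A x = y i := fun i => Ideal.Quotient.mk_surjective (y i)
    choose x hx using this
    exact ⟨x, funext hx⟩
  have hmk0 : ∀ x, mk x = 0 → ∃ y, x = r • y := by
    intro x hx
    have : ∀ i, r ∣ x i := fun i => (hmk _).1 (congrFun hx i)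
    choose y hy using this
    exact ⟨y, funext hy⟩
  obtain ⟨E, hE⟩ := Module.projective_lifting_property mk
    ((s.restrictScalars R).comp (g.comp φ)) hmks
  have hE' : ∀ x, mk (E x) = s (g (φ x)) := fun x => LinearMap.congr_fun hE x
  have hgE : ∀ x, g (φ (E x)) = g (φ x) := by
    intro x; rw [← hψ, hE', hs']
  have hD : ∀ i, ∃ d, E (E (Pi.single i 1)) - E (Pi.single i 1) = r • d := by
    intro i
    apply hmk0
    rw [map_sub, hE', hE', hgE, sub_self]
  choose d hd using hD
  obtain ⟨E', D', h1, h2⟩ := aux_lift_end h E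
    (Fintype.linearCombination R d) (by
      apply LinearMap.pi_ext'
      intro i
      ext1
      simpa [Fintype.linearCombination_apply, Pi.single_apply, Finset.sum_ite_eq] using hd i)
  have h1' : ∀ x, E' (E' x) = E' x := fun x => LinearMap.congr_fun h1 x
  have h2' : ∀ x, E' x = E x + r • D' x := fun x => by
    have := LinearMap.congr_fun h2 x
    rw [LinearMap.sub_apply, sub_eq_iff_eq_add, LinearMap.smul_apply] at this
    rw [this, add_comm]
  -- surjective
  have hsurj : LinearMap.range (φ.comp E') = ⊤ := by
    rw [eq_top_iff]
    refine Submodule.le_of_le_smul_of_le_jacobson_bot (I := Ideal.span {r})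
      Module.Finite.fg_top (IsAdicComplete.le_jacobson_bot _) ?_
    intro l _
    obtain ⟨x, rfl⟩ := hφ l
    obtain ⟨y, hy⟩ := hker (φ x - φ (E' x)) (by
      rw [map_sub, h2' x, map_add, map_add, hgE, map_smul, map_smul, hrQ]; simp)
    rw [sub_eq_iff_eq_add] at hy
    rw [hy]
    refine add_mem (Submodule.mem_sup_right ?_) (Submodule.mem_sup_left ⟨x, rfl⟩)
    exact Submodule.smul_mem_smul (Ideal.mem_span_singleton_self r) trivial
  have hone : ∀ x, E' x = x → φ x = 0 → ∃ y, x = r • y ∧ E' y = y ∧ φ y = 0 := by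
    intro x hx hx0
    obtain ⟨y, hy⟩ := hmk0 (E x) (by rw [hE', hx0, map_zero, map_zero])
    have hx' : x = r • (y + D' x) := by
      rw [smul_add, ← hy, ← h2', hx]
    refine ⟨y + D' x, hx', ?_, ?_⟩
    · generalize y + D' x = z at hx'
      rw [← sub_eq_zero]
      ext i
      apply htf
      have : r • (E' z - z) = 0 := by
        rw [smul_sub, ← map_smul, ← hx', hx, sub_self]
      exact congrFun this i
    · apply hL
      rw [← map_smul, ← hx', hx0]
  have hpow : ∀ n x, E' x = x → φ x = 0 → ∃ y, x = r ^ n • y ∧ E' y = y ∧ φ y = 0 := by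
    intro n
    induction n with
    | zero => intro x h1 h2; exact ⟨x, by simp, h1, h2⟩
    | succ n ih =>
      intro x h1 h2
      obtain ⟨y, rfl, h3, h4⟩ := ih x h1 h2
      obtain ⟨z, rfl, h5, h6⟩ := hone y h3 h4
      exact ⟨z, by rw [smul_smul, pow_succ], h5, h6⟩
  have hinj : ∀ x, E' x = x → φ x = 0 → x = 0 := by
    intro x hx hx0
    ext i
    apply aux_dvd_zero h
    intro n
    obtain ⟨y, rfl, -, -⟩ := hpow n x hx hx0
    exact ⟨y i, rfl⟩
  let e := LinearEquiv.ofBijective (φ.domRestrict (LinearMap.range E')) (by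
    constructor
    · rw [← LinearMap.ker_eq_bot, LinearMap.ker_eq_bot']
      rintro ⟨_, x, rfl⟩ hx
      apply Subtype.ext
      exact hinj _ (h1' x) hx
    · intro l
      obtain ⟨x, hx⟩ : l ∈ LinearMap.range (φ.comp E') := hsurj ▸ trivial
      exact ⟨⟨E' x, x, rfl⟩, hx⟩)
  refine Module.Projective.of_split ((LinearMap.range E').subtype.comp e.symm.toLinearMap) φ ?_
  ext l
  exact e.apply_symm_apply l
end A

section B
open TensorProduct
variable {R : Type u} [CommRing R] {r : R}

theorem aux_ext {K F N M Q : Type u} [AddCommGroup K] [Module R K] [AddCommGroup F] [Module R F]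
    [AddCommGroup N] [Module R N] [AddCommGroup M] [Module R M] [AddCommGroup Q] [Module R Q]
    [Module.Flat R F] (ι : K →ₗ[R] F) (i : N →ₗ[R] M) (g : M →ₗ[R] Q)
    (hi : Function.Injective i) (hg : Function.Surjective g) (hex : Function.Exact i g)
    (hN : Function.Injective (ι.lTensor N)) (hQ : Function.Injective (ι.lTensor Q)) :
    Function.Injective (ι.lTensor M) := by
  rw [← LinearMap.ker_eq_bot, LinearMap.ker_eq_bot']
  intro x hx
  have h1 : g.rTensor K x = 0 := by
    apply hQ
    rw [map_zero, ← LinearMap.comp_apply, LinearMap.lTensor_comp_rTensor,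
      ← LinearMap.rTensor_comp_lTensor, LinearMap.comp_apply, hx, map_zero]
  obtain ⟨y, rfl⟩ := (rTensor_exact K hex hg x).1 h1
  have h2 : i.rTensor F (ι.lTensor N y) = 0 := by
    rw [← hx, ← LinearMap.comp_apply, LinearMap.rTensor_comp_lTensor,
      ← LinearMap.lTensor_comp_rTensor, LinearMap.comp_apply]
  have h3 : ι.lTensor N y = 0 :=
    Module.Flat.rTensor_preserves_injective_linearMap i hi (by rw [h2, map_zero])
  have h4 : y = 0 := hN (by rw [h3, map_zero])
  rw [h4, map_zero]

theorem aux_quot {K F P : Type u} [AddCommGroup K] [Module R K] [AddCommGroup F] [Module R F]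
    [AddCommGroup P] [Module R P] (ι : K →ₗ[R] F) (ε : F →ₗ[R] P)
    (hι : Function.Injective ι) (hex : Function.Exact ι ε)
    (hP : ∀ x : P, r • x = 0 → x = 0) :
    Function.Injective (ι.lTensor (R ⧸ (Ideal.span {r} : Ideal R))) := by
  rw [← LinearMap.ker_eq_bot, LinearMap.ker_eq_bot']
  intro x hx
  obtain ⟨k, rfl⟩ : ∃ k : K, x = (1 : R ⧸ (Ideal.span {r} : Ideal R)) ⊗ₜ[R] k := by
    clear hx
    induction x using TensorProduct.induction_on with
    | zero => exact ⟨0, by simp⟩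
    | tmul a k =>
      obtain ⟨a, rfl⟩ := Ideal.Quotient.mk_surjective a
      refine ⟨a • k, ?_⟩
      rw [← TensorProduct.smul_tmul]
      congr 1
      rw [Algebra.smul_def, mul_one]; rfl
    | add x y hx hy =>
      obtain ⟨k, rfl⟩ := hx
      obtain ⟨l, rfl⟩ := hy
      exact ⟨k + l, (TensorProduct.tmul_add _ _ _).symm⟩
  rw [LinearMap.lTensor_tmul] at hx
  have h1 : ι k ∈ (Ideal.span {r} : Ideal R) • (⊤ : Submodule R F) := by
    have := congrArg (TensorProduct.quotTensorEquivQuotSMul F (Ideal.span {r} : Ideal R)) hx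
    rw [map_zero] at this
    have h3 := TensorProduct.quotTensorEquivQuotSMul_mk_tmul (Ideal.span {r} : Ideal R) (1:R) (ι k)
    rw [map_one, this, one_smul] at h3
    exact (Submodule.Quotient.mk_eq_zero _).1 h3.symm
  rw [Submodule.ideal_span_singleton_smul] at h1
  obtain ⟨f, -, hf⟩ := h1
  change r • f = ι k at hf
  have h2 : ε f = 0 := hP _ (by rw [← map_smul, hf]; exact hex.apply_apply_eq_zero k)
  obtain ⟨k', rfl⟩ := (hex f).1 h2
  rw [← map_smul] at hf
  rw [← hι hf, ← TensorProduct.smul_tmul, Algebra.smul_def, mul_one]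
  have : algebraMap R (R ⧸ (Ideal.span {r} : Ideal R)) r = 0 :=
    Ideal.Quotient.eq_zero_iff_mem.2 (Ideal.mem_span_singleton_self r)
  rw [this, zero_tmul]

theorem aux_proj {K F Q A : Type u} [CommRing A] [Algebra R A]
    [AddCommGroup K] [Module R K] [AddCommGroup F] [Module R F]
    [AddCommGroup Q] [Module R Q] [Module A Q] [IsScalarTower R A Q] [Module.Projective A Q]
    (ι : K →ₗ[R] F) (h : Function.Injective (ι.lTensor A)) :
    Function.Injective (ι.lTensor Q) := by
  obtain ⟨s, hs⟩ := Module.Projective.out (R := A) (P := Q)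
  let s' : Q →ₗ[R] (Q →₀ A) := s.restrictScalars R
  let p' : (Q →₀ A) →ₗ[R] Q := (Finsupp.linearCombination A id).restrictScalars R
  have hps : p'.comp s' = LinearMap.id := LinearMap.ext hs
  have hfree : Function.Injective (ι.lTensor (Q →₀ A)) := by
    classical
    intro x y hxy
    apply (TensorProduct.finsuppLeft R R A K Q).injective
    ext q
    rw [TensorProduct.finsuppLeft_apply, TensorProduct.finsuppLeft_apply]
    apply h
    rw [← LinearMap.comp_apply, ← LinearMap.comp_apply, LinearMap.lTensor_comp_rTensor,
      ← LinearMap.rTensor_comp_lTensor, LinearMap.comp_apply, LinearMap.comp_apply, hxy]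
  rw [← LinearMap.ker_eq_bot, LinearMap.ker_eq_bot']
  intro x hx
  have h1 : s'.rTensor K x = 0 := by
    apply hfree
    rw [map_zero, ← LinearMap.comp_apply, LinearMap.lTensor_comp_rTensor,
      ← LinearMap.rTensor_comp_lTensor, LinearMap.comp_apply, hx, map_zero]
  have h2 := congrArg (p'.rTensor K) h1
  rwa [← LinearMap.comp_apply, ← LinearMap.rTensor_comp, hps, LinearMap.rTensor_id, map_zero] at h2

open CategoryTheory in
theorem aux_tor (M P : Type u) [AddCommGroup M] [Module R M] [AddCommGroup P] [Module R P]
    (H : ∀ (K F : Type u) [AddCommGroup K] [Module R K] [AddCommGroup F] [Module R F]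
      [Module.Flat R F] (ι : K →ₗ[R] F) (ε : F →ₗ[R] P), Function.Injective ι →
      Function.Exact ι ε → Function.Injective (ι.lTensor M)) :
    Limits.IsZero (((Tor (ModuleCat.{u} R) 1).obj (ModuleCat.of R M)).obj (ModuleCat.of R P)) := by
  let X := projectiveResolution (ModuleCat.of R P)
  refine Limits.IsZero.of_iso ?_ (X.isoLeftDerivedObj
    ((MonoidalCategory.tensoringLeft (ModuleCat.{u} R)).obj (ModuleCat.of R M)) 1)
  refine (HomologicalComplex.exactAt_iff_isZero_homology _ _).1 ?_
  rw [HomologicalComplex.exactAt_iff' _ 2 1 0 (by simp) (by simp)]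
  rw [ShortComplex.ShortExact.moduleCat_exact_iff_function_exact]
  have hex1 : Function.Exact (X.complex.d 2 1).hom (X.complex.d 1 0).hom := by
    have := X.complex_exactAt_succ 0
    rw [HomologicalComplex.exactAt_iff' _ 2 1 0 (by simp) (by simp)] at this
    exact (ShortComplex.ShortExact.moduleCat_exact_iff_function_exact _).1 this
  have hex0 : Function.Exact (X.complex.d 1 0).hom (X.π.f 0).hom := 
    (ShortComplex.ShortExact.moduleCat_exact_iff_function_exact _).1 X.exact₀
  have : Module.Flat R (X.complex.X 0) := by
    have : Module.Projective R (X.complex.X 0) :=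
      (IsProjective.iff_projective _ ).2 (X.projective 0)
    infer_instance
  have hinj := H (LinearMap.range (X.complex.d 1 0).hom) (X.complex.X 0)
    (Submodule.subtype _) (X.π.f 0).hom Subtype.val_injective (by
      intro x
      refine (hex0 x).trans ?_
      simp)
  have hq : Function.Exact (X.complex.d 2 1).hom (X.complex.d 1 0).hom.rangeRestrict := by
    intro x
    rw [← hex1 x, ← Subtype.coe_inj]; rfl
  have hT := lTensor_exact M hq (LinearMap.surjective_rangeRestrict _)
  have hT2 : Function.Exact ((X.complex.d 2 1).hom.lTensor M) ((X.complex.d 1 0).hom.lTensor M) := by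
    intro x
    rw [← hT x]
    have : (X.complex.d 1 0).hom.lTensor M x =
      (Submodule.subtype _).lTensor M ((X.complex.d 1 0).hom.rangeRestrict.lTensor M x) := by
      rw [← LinearMap.comp_apply, ← LinearMap.lTensor_comp]; rfl
    rw [this]
    exact map_eq_zero_iff _ hinj
  exact hT2
end B

theorem aux_devissage {R : Type u} [CommRing R] (r : R) (hR : IsDevissageSetup R r)
    (M : Type u) [AddCommGroup M] [Module R M]
    (hfp : Module.FinitePresentation R M) (hdev : HasFinProjMuDevissage r M)
    (hbd : BoundedRTorsion r M)
    (P : Type u) [AddCommGroup P] [Module R P] (hP : ∀ x : P, r • x = 0 → x = 0)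
    (K F : Type u) [AddCommGroup K] [Module R K] [AddCommGroup F] [Module R F]
    [Module.Flat R F] (ι : K →ₗ[R] F) (ε : F →ₗ[R] P) (hι : Function.Injective ι)
    (hex : Function.Exact ι ε) : Function.Injective (ι.lTensor M) := by
  obtain ⟨N, -, hN⟩ := hbd
  -- the quotient maps
  have hmem : ∀ (n : ℕ) (x : M), x ∈ r ^ n • (⊤ : Submodule R M) ↔ ∃ m, r ^ n • m = x := by
    intro n x
    rw [Submodule.mem_smul_pointwise_iff_exists]
    simp
  have hle : ∀ n : ℕ, r ^ (n + 1) • (⊤ : Submodule R M) ≤ r ^ n • (⊤ : Submodule R M) := by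
    intro n x hx
    obtain ⟨m, rfl⟩ := (hmem _ _).1 hx
    exact (hmem _ _).2 ⟨r • m, by rw [smul_smul, pow_succ]⟩
  let g : ∀ n : ℕ, ↥(r ^ n • (⊤ : Submodule R M)) →ₗ[R] muQuotSub r M n := fun n =>
    (r ^ (n + 1) • (⊤ : Submodule R M)).mkQ.restrict
      (fun x hx => Submodule.mem_map_of_mem hx)
  have hgs : ∀ n, Function.Surjective (g n) := by
    rintro n ⟨_, x, hx, rfl⟩
    exact ⟨⟨x, hx⟩, rfl⟩
  have hg0 : ∀ n x, g n x = 0 ↔ (x : M) ∈ r ^ (n + 1) • (⊤ : Submodule R M) := by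
    intro n x
    rw [← Submodule.Quotient.mk_eq_zero, ← Subtype.coe_inj]
    rfl
  have hquot : ∀ n, Function.Injective (ι.lTensor (muQuotSub r M n)) := by
    intro n
    letI := (muQuotSub_isTorsionBySet r M n).module
    have : IsScalarTower R (R ⧸ (Ideal.span {r} : Ideal R)) (muQuotSub r M n) :=
      (muQuotSub_isTorsionBySet r M n).isScalarTower
    have : Module.Projective (R ⧸ (Ideal.span {r} : Ideal R)) (muQuotSub r M n) := (hdev n).2.1
    exact aux_proj (A := R ⧸ (Ideal.span {r} : Ideal R)) ι (aux_quot ι ε hι hex hP)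
  have hbase : Function.Injective (ι.lTensor ↥(r ^ N • (⊤ : Submodule R M))) := by
    letI := (muQuotSub_isTorsionBySet r M N).module
    have : IsScalarTower R (R ⧸ (Ideal.span {r} : Ideal R)) (muQuotSub r M N) :=
      (muQuotSub_isTorsionBySet r M N).isScalarTower
    have : Module.Projective (R ⧸ (Ideal.span {r} : Ideal R)) (muQuotSub r M N) := (hdev N).2.1
    have : Module.Finite R ↥(r ^ N • (⊤ : Submodule R M)) :=
      Module.Finite.iff_fg.2 (Submodule.FG.map _ Module.Finite.fg_top)
    have : Module.Projective R ↥(r ^ N • (⊤ : Submodule R M)) := by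
      refine aux_projective hR.adicComplete hR.torsionFree ?_ (g N) (hgs N) ?_
      · rintro ⟨x, hx⟩ hx0
        obtain ⟨m, rfl⟩ := (hmem _ _).1 hx
        apply Subtype.ext
        refine hN m ⟨N + 1, ?_⟩
        rw [pow_succ', mul_smul]
        exact congrArg Subtype.val hx0
      · intro x hx
        obtain ⟨m, hm⟩ := (hmem _ _).1 ((hg0 N x).1 hx)
        refine ⟨⟨r ^ N • m, (hmem _ _).2 ⟨m, rfl⟩⟩, Subtype.ext ?_⟩
        rw [← hm, pow_succ', mul_smul]
        rfl
    exact Module.Flat.lTensor_preserves_injective_linearMap ι hι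
  have hall : ∀ j n : ℕ, n + j = N →
      Function.Injective (ι.lTensor ↥(r ^ n • (⊤ : Submodule R M))) := by
    intro j
    induction j with
    | zero => rintro n rfl; exact hbase
    | succ j ih =>
      intro n hn
      refine aux_ext ι (Submodule.inclusion (hle n)) (g n)
        (Submodule.inclusion_injective _) (hgs n) ?_ (ih (n + 1) (by omega)) (hquot n)
      intro x
      rw [hg0]
      constructor
      · intro hx; exact ⟨⟨x, hx⟩, rfl⟩
      · rintro ⟨y, rfl⟩; exact y.2
  have h0 := hall N 0 (by omega)
  rw [← LinearMap.ker_eq_bot, LinearMap.ker_eq_bot']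
  intro x hx
  let i : M →ₗ[R] ↥(r ^ 0 • (⊤ : Submodule R M)) :=
    LinearMap.id.codRestrict _ (fun m => (hmem 0 m).2 ⟨m, by simp⟩)
  have h1 : i.rTensor K x = 0 := by
    apply h0
    rw [map_zero, ← LinearMap.comp_apply, LinearMap.lTensor_comp_rTensor,
      ← LinearMap.rTensor_comp_lTensor, LinearMap.comp_apply, hx, map_zero]
  have h2 := congrArg ((Submodule.subtype _).rTensor K) h1
  rw [← LinearMap.comp_apply, ← LinearMap.rTensor_comp, map_zero] at h2
  have h3 : (Submodule.subtype _).comp i = LinearMap.id := rfl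
  rwa [h3, LinearMap.rTensor_id] at h2

open CategoryTheory in
/-- for a dévissage setup `(R,r)` and a finitely presented `R`-module `M`
with finite projective `(r,μ)`-dévissage and bounded `r^∞`-torsion, `Tor₁^R(M,P)` vanishes
for every `r`-torsion-free `R`-module `P`. -/
theorem tor_one_vanishing {R : Type u} [CommRing R] (r : R) (hR : IsDevissageSetup R r)
    (M : Type u) [AddCommGroup M] [Module R M]
    (hfp : Module.FinitePresentation R M) (hdev : HasFinProjMuDevissage r M)
    (hbd : BoundedRTorsion r M)
    (P : Type u) [AddCommGroup P] [Module R P] (hP : ∀ x : P, r • x = 0 → x = 0) :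
    Limits.IsZero (((Tor (ModuleCat.{u} R) 1).obj (ModuleCat.of R M)).obj (ModuleCat.of R P)) := by
  exact aux_tor M P (fun K F _ _ _ _ _ ι ε hι hex =>
    aux_devissage r hR M hfp hdev hbd P hP K F ι ε hι hex)
end

section
/- Let (R, r) be a dévissage setup and let M be a finitely presented R-module with finite projective (r,μ)-dévissage and bounded r^∞-torsion. Then M has finite projective (r,τ)-dévissage: for every n ≥ 0 the quotient M[r^{n+1}]/M[rⁿ] (where M[rᵏ] denotes the submodule of elements killed by rᵏ), viewed as a module over R/rR, is finitely generated, projective, and of constant rank. -/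
open Pointwise

universe u

section Tau

variable {R : Type u} [CommRing R]

/-- the subquotient `M[r^{n+1}]/M[rⁿ]`, realized as a submodule of `M/M[rⁿ]`. -/
def tauQuotSub (r : R) (M : Type u) [AddCommGroup M] [Module R M] (n : ℕ) :
    Submodule R (M ⧸ Submodule.torsionBy R M (r ^ n)) :=
  (Submodule.torsionBy R M (r ^ (n + 1))).map (Submodule.torsionBy R M (r ^ n)).mkQ

theorem tauQuotSub_isTorsionBySet (r : R) (M : Type u) [AddCommGroup M] [Module R M] (n : ℕ) :
    Module.IsTorsionBySet R (tauQuotSub r M n) ((Ideal.span {r} : Ideal R) : Set R) := by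
  refine (Module.isTorsionBySet_span_singleton_iff r).mpr ?_
  rintro ⟨x, hx⟩
  obtain ⟨m, hm, rfl⟩ := hx
  apply Subtype.ext
  show r • ((Submodule.torsionBy R M (r ^ n)).mkQ m) = 0
  rw [← map_smul, Submodule.mkQ_apply, Submodule.Quotient.mk_eq_zero,
    Submodule.mem_torsionBy_iff, smul_smul, ← pow_succ]
  exact (Submodule.mem_torsionBy_iff _ _).mp hm

/-- `M` has finite projective `(r,τ)`-dévissage. -/
def HasFinProjTauDevissage (r : R) (M : Type u) [AddCommGroup M] [Module R M] : Prop :=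
  ∀ n : ℕ,
    letI := (tauQuotSub_isTorsionBySet r M n).module
    FinProjConstRank (R ⧸ (Ideal.span {r} : Ideal R)) (tauQuotSub r M n)

end Tau

section Aux

theorem constRank_iff (A : Type u) [CommRing A] (Q : Type u) [AddCommGroup Q] [Module A Q]
    [Module.Finite A Q] [Module.Projective A Q] :
    ConstRank A Q ↔ ∃ c : ℕ, ∀ p : PrimeSpectrum A, Module.rankAtStalk Q p = c := by
  constructor
  · rintro ⟨c, h⟩
    refine ⟨c, fun p => ?_⟩
    obtain ⟨e⟩ := h p.asIdeal p.2
    rw [Module.rankAtStalk, e.finrank_eq, Module.finrank_fin_fun]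
  · rintro ⟨c, h⟩
    refine ⟨c, fun p hp => ?_⟩
    have hc := h ⟨p, hp⟩
    have : Module.Free (Localization.AtPrime p) (LocalizedModule p.primeCompl Q) :=
      Module.free_of_flat_of_isLocalRing
    exact ⟨LinearEquiv.ofFinrankEq _ _ (by rw [Module.finrank_fin_fun]; exact hc)⟩

theorem exists_equiv_prod {A : Type u} [CommRing A] {K P Q : Type u} [AddCommGroup K]
    [AddCommGroup P] [AddCommGroup Q] [Module A K] [Module A P] [Module A Q]
    [Module.Projective A Q] (f : K →ₗ[A] P) (g : P →ₗ[A] Q) (hf : Function.Injective f)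
    (hg : Function.Surjective g) (h : Function.Exact f g) : Nonempty (P ≃ₗ[A] K × Q) := by
  obtain ⟨l, hl⟩ := Module.projective_lifting_property g LinearMap.id hg
  exact ⟨(h.splitSurjectiveEquiv hf ⟨l, hl⟩).1⟩

theorem fpcr_mid {A : Type u} [CommRing A] {K P Q : Type u} [AddCommGroup K]
    [AddCommGroup P] [AddCommGroup Q] [Module A K] [Module A P] [Module A Q]
    (f : K →ₗ[A] P) (g : P →ₗ[A] Q) (hf : Function.Injective f)
    (hg : Function.Surjective g) (h : Function.Exact f g)
    (hK : FinProjConstRank A K) (hQ : FinProjConstRank A Q) : FinProjConstRank A P := by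
  obtain ⟨hK1, hK2, hK3⟩ := hK
  obtain ⟨hQ1, hQ2, hQ3⟩ := hQ
  obtain ⟨e⟩ := exists_equiv_prod f g hf hg h
  have h1 : Module.Finite A P := Module.Finite.equiv e.symm
  have h2 : Module.Projective A P := Module.Projective.of_equiv e.symm
  refine ⟨h1, h2, ?_⟩
  rw [constRank_iff] at *
  obtain ⟨a, ha⟩ := hK3
  obtain ⟨b, hb⟩ := hQ3
  refine ⟨a + b, fun p => ?_⟩
  rw [Module.rankAtStalk_eq_of_equiv e, Module.rankAtStalk_prod, Pi.add_apply, ha, hb]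

theorem fpcr_left {A : Type u} [CommRing A] {K P Q : Type u} [AddCommGroup K]
    [AddCommGroup P] [AddCommGroup Q] [Module A K] [Module A P] [Module A Q]
    (f : K →ₗ[A] P) (g : P →ₗ[A] Q) (hf : Function.Injective f)
    (hg : Function.Surjective g) (h : Function.Exact f g)
    (hP : FinProjConstRank A P) (hQ : FinProjConstRank A Q) : FinProjConstRank A K := by
  obtain ⟨hP1, hP2, hP3⟩ := hP
  obtain ⟨hQ1, hQ2, hQ3⟩ := hQ
  obtain ⟨e⟩ := exists_equiv_prod f g hf hg h
  have h1 : Module.Finite A K := Module.Finite.of_surjective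
    (LinearMap.fst A K Q ∘ₗ e.toLinearMap) (Prod.fst_surjective.comp e.surjective)
  have h2 : Module.Projective A K := Module.Projective.of_split
    (e.symm.toLinearMap ∘ₗ LinearMap.inl A K Q) (LinearMap.fst A K Q ∘ₗ e.toLinearMap)
    (by ext; simp)
  refine ⟨h1, h2, ?_⟩
  rw [constRank_iff] at *
  obtain ⟨a, ha⟩ := hP3
  obtain ⟨b, hb⟩ := hQ3
  refine ⟨a - b, fun p => ?_⟩
  have := ha p
  rw [Module.rankAtStalk_eq_of_equiv e, Module.rankAtStalk_prod, Pi.add_apply, hb] at this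
  omega

theorem fpcr_four {A : Type u} [CommRing A] {K T G H : Type u} [AddCommGroup K]
    [AddCommGroup T] [AddCommGroup G] [AddCommGroup H] [Module A K] [Module A T] [Module A G]
    [Module A H] (f : K →ₗ[A] T) (g : T →ₗ[A] G) (h : G →ₗ[A] H) (hf : Function.Injective f)
    (hh : Function.Surjective h) (hfg : Function.Exact f g) (hgh : Function.Exact g h)
    (hK : FinProjConstRank A K) (hG : FinProjConstRank A G) (hH : FinProjConstRank A H) :
    FinProjConstRank A T := by
  have hL : FinProjConstRank A (LinearMap.ker h) :=
    fpcr_left (LinearMap.ker h).subtype h (Submodule.injective_subtype _) hh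
      (LinearMap.exact_subtype_ker_map h) hG hH
  refine fpcr_mid f (g.codRestrict (LinearMap.ker h) fun x => ?_) hf ?_ ?_ hK hL
  · exact (hgh _).2 ⟨x, rfl⟩
  · rintro ⟨y, hy⟩
    obtain ⟨x, rfl⟩ := (hgh y).1 hy
    exact ⟨x, rfl⟩
  · intro x
    rw [← hfg x, ← Subtype.coe_inj]
    rfl

theorem fpcr_four' {R A : Type u} [CommRing R] [CommRing A] [Algebra R A]
    (hs : Function.Surjective (algebraMap R A)) {K T G H : Type u} [AddCommGroup K]
    [AddCommGroup T] [AddCommGroup G] [AddCommGroup H] [Module A K] [Module A T] [Module A G]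
    [Module A H] [Module R K] [Module R T] [Module R G] [Module R H] [IsScalarTower R A K]
    [IsScalarTower R A T] [IsScalarTower R A G] [IsScalarTower R A H]
    (f : K →ₗ[R] T) (g : T →ₗ[R] G) (h : G →ₗ[R] H) (hf : Function.Injective f)
    (hh : Function.Surjective h) (hfg : Function.Exact f g) (hgh : Function.Exact g h)
    (hK : FinProjConstRank A K) (hG : FinProjConstRank A G) (hH : FinProjConstRank A H) :
    FinProjConstRank A T :=
  fpcr_four (f.extendScalarsOfSurjective hs) (g.extendScalarsOfSurjective hs)
    (h.extendScalarsOfSurjective hs) hf hh hfg hgh hK hG hH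

theorem fpcr_zero {A : Type u} [CommRing A] {K : Type u} [AddCommGroup K] [Module A K]
    [Subsingleton K] : FinProjConstRank A K := by
  have h1 : Module.Finite A K := inferInstance
  have h2 : Module.Projective A K := inferInstance
  refine ⟨h1, h2, (constRank_iff A K).2 ⟨0, fun p => ?_⟩⟩
  rw [Module.rankAtStalk_eq_zero_of_subsingleton]; rfl

variable {R : Type u} [CommRing R] (r : R) (M : Type u) [AddCommGroup M] [Module R M] (n : ℕ)

theorem mem_smul_top {a : R} {x : M} : x ∈ a • (⊤ : Submodule R M) ↔ ∃ y, a • y = x := by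
  rw [Submodule.mem_smul_pointwise_iff_exists]; simp

def tauMk (x : M) (hx : r ^ (n + 1) • x = 0) : tauQuotSub r M n :=
  ⟨(Submodule.torsionBy R M (r ^ n)).mkQ x, x, (Submodule.mem_torsionBy_iff _ _).2 hx, rfl⟩

def muMk (x : M) : muQuotSub r M n :=
  ⟨(r ^ (n + 1) • (⊤ : Submodule R M)).mkQ (r ^ n • x), r ^ n • x,
    (mem_smul_top M).2 ⟨x, rfl⟩, rfl⟩

theorem tauMk_surj (t : tauQuotSub r M n) : ∃ x hx, t = tauMk r M n x hx := by
  obtain ⟨_, x, hx, rfl⟩ := t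
  exact ⟨x, (Submodule.mem_torsionBy_iff _ _).1 hx, rfl⟩

theorem muMk_surj (t : muQuotSub r M n) : ∃ x, t = muMk r M n x := by
  obtain ⟨_, x, hx, rfl⟩ := t
  obtain ⟨y, rfl⟩ := (mem_smul_top M).1 hx
  exact ⟨y, rfl⟩

theorem tauMk_eq_zero (x : M) (hx : r ^ (n + 1) • x = 0) :
    tauMk r M n x hx = 0 ↔ r ^ n • x = 0 := by
  rw [← Subtype.coe_inj, ← Submodule.mem_torsionBy_iff]
  exact Submodule.Quotient.mk_eq_zero _

theorem muMk_eq_zero (x : M) : muMk r M n x = 0 ↔ ∃ y, r ^ (n + 1) • y = r ^ n • x := by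
  rw [← Subtype.coe_inj, ← mem_smul_top]
  exact Submodule.Quotient.mk_eq_zero _

theorem tauMap_aux : Submodule.torsionBy R M (r ^ (n + 1)) ≤
    (Submodule.torsionBy R M (r ^ n)).comap (LinearMap.lsmul R M r) := by
  intro x hx
  rw [Submodule.mem_comap, Submodule.mem_torsionBy_iff, LinearMap.lsmul_apply, smul_smul,
    ← pow_succ]
  exact (Submodule.mem_torsionBy_iff _ _).1 hx

def tauMap : tauQuotSub r M (n + 1) →ₗ[R] tauQuotSub r M n :=
  (Submodule.mapQ _ _ (LinearMap.lsmul R M r) (tauMap_aux r M n)).restrict (by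
    rintro _ ⟨x, hx, rfl⟩
    exact ⟨r • x, tauMap_aux r M (n + 1) hx, rfl⟩)

theorem tauMap_mk (x : M) (hx : r ^ (n + 1 + 1) • x = 0) :
    tauMap r M n (tauMk r M (n + 1) x hx) =
      tauMk r M n (r • x) (by rw [smul_smul, ← pow_succ]; exact hx) := rfl

theorem muMap_aux : (r ^ (n + 1) • (⊤ : Submodule R M)) ≤
    (r ^ (n + 1 + 1) • (⊤ : Submodule R M)).comap (LinearMap.lsmul R M r) := by
  intro x hx
  obtain ⟨y, rfl⟩ := (mem_smul_top M).1 hx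
  exact (mem_smul_top M).2 ⟨y, by rw [LinearMap.lsmul_apply, smul_smul, ← pow_succ']⟩

def muMap : muQuotSub r M n →ₗ[R] muQuotSub r M (n + 1) :=
  (Submodule.mapQ _ _ (LinearMap.lsmul R M r) (muMap_aux r M n)).restrict (by
    rintro _ ⟨x, hx, rfl⟩
    obtain ⟨y, rfl⟩ := (mem_smul_top M).1 hx
    exact ⟨r • r ^ n • y, (mem_smul_top M).2 ⟨y, by rw [smul_smul, ← pow_succ']⟩, rfl⟩)

theorem muMap_mk (x : M) : muMap r M n (muMk r M n x) = muMk r M (n + 1) x := by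
  apply Subtype.ext
  change (r ^ (n + 1 + 1) • (⊤ : Submodule R M)).mkQ (r • r ^ n • x) =
    (r ^ (n + 1 + 1) • (⊤ : Submodule R M)).mkQ (r ^ (n + 1) • x)
  rw [smul_smul, ← pow_succ']

def conMap : tauQuotSub r M n →ₗ[R] muQuotSub r M n :=
  (Submodule.liftQ (Submodule.torsionBy R M (r ^ n))
    ((r ^ (n + 1) • (⊤ : Submodule R M)).mkQ ∘ₗ LinearMap.lsmul R M (r ^ n)) (by
      intro x hx
      have := (Submodule.mem_torsionBy_iff _ _).1 hx
      simp [this])).restrict (by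
    rintro _ ⟨x, hx, rfl⟩
    exact (muMk r M n x).2)

theorem conMap_mk (x : M) (hx) : conMap r M n (tauMk r M n x hx) = muMk r M n x := rfl

theorem tauMap_inj : Function.Injective (tauMap r M n) := by
  rw [injective_iff_map_eq_zero]
  intro t ht
  obtain ⟨x, hx, rfl⟩ := tauMk_surj r M _ t
  rw [tauMap_mk, tauMk_eq_zero, smul_smul, ← pow_succ] at ht
  rwa [tauMk_eq_zero]

theorem muMap_surj : Function.Surjective (muMap r M n) := by
  intro t
  obtain ⟨x, rfl⟩ := muMk_surj r M _ t
  exact ⟨_, muMap_mk r M n x⟩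

theorem exact_left : Function.Exact (tauMap r M n) (conMap r M n) := by
  intro t
  obtain ⟨x, hx, rfl⟩ := tauMk_surj r M _ t
  rw [conMap_mk, muMk_eq_zero]
  constructor
  · rintro ⟨y, hy⟩
    refine ⟨tauMk r M (n + 1) y ?_, ?_⟩
    · rw [pow_succ', mul_smul, hy, smul_smul, ← pow_succ', hx]
    · rw [tauMap_mk, ← sub_eq_zero]
      have h := (tauMk_eq_zero r M n (r • y - x) (by
        rw [smul_sub, hx, smul_smul, ← pow_succ, pow_succ', mul_smul, hy, smul_smul,
          ← pow_succ', hx, sub_zero])).2 (by rw [smul_sub, smul_smul, ← pow_succ, hy, sub_self])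
      rw [← h]
      apply Subtype.ext
      exact (map_sub (Submodule.torsionBy R M (r ^ n)).mkQ _ _).symm
  · rintro ⟨s, hs⟩
    obtain ⟨y, hy, rfl⟩ := tauMk_surj r M _ s
    refine ⟨y, ?_⟩
    rw [tauMap_mk] at hs
    have h2 := congrArg Subtype.val hs
    have h3 := (Submodule.Quotient.eq _).1 h2
    rw [Submodule.mem_torsionBy_iff, smul_sub, smul_smul, ← pow_succ, sub_eq_zero] at h3
    exact h3

theorem exact_right : Function.Exact (conMap r M n) (muMap r M n) := by
  intro t
  obtain ⟨x, rfl⟩ := muMk_surj r M _ t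
  rw [muMap_mk, muMk_eq_zero]
  constructor
  · rintro ⟨y, hy⟩
    refine ⟨tauMk r M n (x - r • y) ?_, ?_⟩
    · rw [smul_sub, smul_smul, ← pow_succ, hy, sub_self]
    · rw [conMap_mk]
      apply Subtype.ext
      refine (Submodule.Quotient.eq _).2 ((mem_smul_top M).2 ⟨-y, ?_⟩)
      rw [smul_sub, smul_smul, ← pow_succ, smul_neg]; abel
  · rintro ⟨s, hs⟩
    obtain ⟨y, hy, rfl⟩ := tauMk_surj r M _ s
    rw [conMap_mk] at hs
    have h2 := congrArg Subtype.val hs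
    have h3 := (Submodule.Quotient.eq _).1 h2
    obtain ⟨z, hz⟩ := (mem_smul_top M).1 h3
    refine ⟨-z, ?_⟩
    have h4 : r ^ (n + 1 + 1) • z = r ^ (n + 1) • y - r ^ (n + 1) • x := by
      rw [pow_succ' r (n + 1), mul_smul, hz, smul_sub, smul_smul, smul_smul, ← pow_succ']
    rw [smul_neg, h4, hy]; abel

theorem tau_subsingleton {N : ℕ} (hN : ∀ x : M, (∃ k : ℕ, r ^ k • x = 0) → r ^ N • x = 0)
    (h : N ≤ n) : Subsingleton (tauQuotSub r M n) := by
  refine subsingleton_of_forall_eq 0 fun t => ?_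
  obtain ⟨x, hx, rfl⟩ := tauMk_surj r M _ t
  rw [tauMk_eq_zero, ← Nat.sub_add_cancel h, pow_add, mul_smul, hN x ⟨_, hx⟩, smul_zero]

end Aux

/-- a finitely presented module with finite projective `(r,μ)`-dévissage and
bounded `r^∞`-torsion has finite projective `(r,τ)`-dévissage. -/
theorem tau_devissage_of_mu_devissage {R : Type u} [CommRing R] (r : R)
    (hR : IsDevissageSetup R r) (M : Type u) [AddCommGroup M] [Module R M]
    (hfp : Module.FinitePresentation R M) (hdev : HasFinProjMuDevissage r M)
    (hbd : BoundedRTorsion r M) :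
    HasFinProjTauDevissage r M := by
  obtain ⟨N, -, hN⟩ := hbd
  have key : ∀ k n : ℕ, N ≤ n + k →
      letI := (tauQuotSub_isTorsionBySet r M n).module
      FinProjConstRank (R ⧸ (Ideal.span {r} : Ideal R)) (tauQuotSub r M n) := by
    intro k
    induction k with
    | zero =>
      intro n hn
      letI := (tauQuotSub_isTorsionBySet r M n).module
      have := tau_subsingleton r M n hN hn
      exact fpcr_zero
    | succ k ih =>
      intro n hn
      letI := (tauQuotSub_isTorsionBySet r M n).module
      letI := (tauQuotSub_isTorsionBySet r M (n + 1)).module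
      letI := (muQuotSub_isTorsionBySet r M n).module
      letI := (muQuotSub_isTorsionBySet r M (n + 1)).module
      have := (tauQuotSub_isTorsionBySet r M n).isScalarTower (S := R)
      have := (tauQuotSub_isTorsionBySet r M (n + 1)).isScalarTower (S := R)
      have := (muQuotSub_isTorsionBySet r M n).isScalarTower (S := R)
      have := (muQuotSub_isTorsionBySet r M (n + 1)).isScalarTower (S := R)
      exact fpcr_four' (R := R) Ideal.Quotient.mk_surjective (tauMap r M n) (conMap r M n)
        (muMap r M n) (tauMap_inj r M n) (muMap_surj r M n) (exact_left r M n)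
        (exact_right r M n) (ih (n + 1) (by omega)) (hdev n) (hdev (n + 1))
  exact fun n => key N n (by omega)
end

section
/- Let (R, r) be a dévissage setup, let N ≥ 1, and let M be an R-module killed by r^N having finite projective (r,μ)-dévissage. Then for every r-torsion-free R-module P (i.e. r·x = 0 implies x = 0 in P), the group Tor₁^R(M, P) vanishes. -/
open Pointwise

universe u

open TensorProduct in
theorem devHelper_exact_ext {R : Type u} [CommRing R]
    {F₂ F₁ F₀ : Type u} [AddCommGroup F₂] [Module R F₂] [AddCommGroup F₁] [Module R F₁]
    [AddCommGroup F₀] [Module R F₀] [Module.Flat R F₀]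
    (d₂ : F₂ →ₗ[R] F₁) (d₁ : F₁ →ₗ[R] F₀) (hd : ∀ x, d₁ (d₂ x) = 0)
    {A B C : Type u} [AddCommGroup A] [Module R A] [AddCommGroup B] [Module R B]
    [AddCommGroup C] [Module R C] (f : A →ₗ[R] B) (g : B →ₗ[R] C)
    (hf : Function.Injective f) (hfg : Function.Exact f g) (hg : Function.Surjective g)
    (hA : Function.Exact (d₂.lTensor A) (d₁.lTensor A))
    (hC : Function.Exact (d₂.lTensor C) (d₁.lTensor C)) :
    Function.Exact (d₂.lTensor B) (d₁.lTensor B) := by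
  have hcomp : d₁.lTensor B ∘ₗ d₂.lTensor B = 0 := by
    rw [← LinearMap.lTensor_comp, show d₁ ∘ₗ d₂ = 0 from LinearMap.ext hd, LinearMap.lTensor_zero]
  have comm : ∀ {X Y : Type u} [AddCommGroup X] [Module R X] [AddCommGroup Y] [Module R Y]
      {S T : Type u} [AddCommGroup S] [Module R S] [AddCommGroup T] [Module R T]
      (h : X →ₗ[R] Y) (d : S →ₗ[R] T) (x : X ⊗[R] S),
      d.lTensor Y (h.rTensor S x) = h.rTensor T (d.lTensor X x) := by
    intro X Y _ _ _ _ S T _ _ _ _ h d x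
    rw [← LinearMap.comp_apply, ← LinearMap.comp_apply, LinearMap.lTensor_comp_rTensor,
      LinearMap.rTensor_comp_lTensor]
  intro x
  constructor
  · intro hx
    obtain ⟨y'', hy''⟩ := (hC (g.rTensor F₁ x)).1 (by rw [comm, hx, map_zero])
    obtain ⟨y, rfl⟩ := LinearMap.rTensor_surjective F₂ hg y''
    obtain ⟨z, hz⟩ := (rTensor_exact F₁ hfg hg (x - d₂.lTensor B y)).1 (by
      rw [map_sub, ← comm, hy'', sub_self])
    have hz0 : d₁.lTensor A z = 0 := by
      apply Module.Flat.rTensor_preserves_injective_linearMap (M := F₀) f hf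
      rw [← comm, hz, map_sub, hx, map_zero, zero_sub, neg_eq_zero]
      exact LinearMap.congr_fun hcomp y
    obtain ⟨w, rfl⟩ := (hA z).1 hz0
    refine ⟨y + f.rTensor F₂ w, ?_⟩
    rw [map_add, comm, hz]
    abel
  · rintro ⟨y, rfl⟩
    exact LinearMap.congr_fun hcomp y

open TensorProduct in
theorem devHelper_exact_quot {R : Type u} [CommRing R] (r : R)
    {F₂ F₁ F₀ P : Type u} [AddCommGroup F₂] [Module R F₂] [AddCommGroup F₁] [Module R F₁]
    [AddCommGroup F₀] [Module R F₀] [AddCommGroup P] [Module R P]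
    (d₂ : F₂ →ₗ[R] F₁) (d₁ : F₁ →ₗ[R] F₀) (π : F₀ →ₗ[R] P)
    (h₁ : Function.Exact d₂ d₁) (h₀ : Function.Exact d₁ π)
    (hP : ∀ x : P, r • x = 0 → x = 0) :
    Function.Exact (d₂.lTensor (R ⧸ (Ideal.span {r} : Ideal R)))
      (d₁.lTensor (R ⧸ (Ideal.span {r} : Ideal R))) := by
  have hcomp : d₁.lTensor (R ⧸ (Ideal.span {r} : Ideal R)) ∘ₗ
      d₂.lTensor (R ⧸ (Ideal.span {r} : Ideal R)) = 0 := by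
    rw [← LinearMap.lTensor_comp,
      show d₁ ∘ₗ d₂ = 0 from LinearMap.ext h₁.apply_apply_eq_zero, LinearMap.lTensor_zero]
  intro x
  constructor
  · intro hx
    obtain ⟨x, rfl⟩ : ∃ y : F₁, (1 : R ⧸ (Ideal.span {r} : Ideal R)) ⊗ₜ[R] y = x :=
      TensorProduct.mk_surjective R F₁ (R ⧸ (Ideal.span {r} : Ideal R))
        Ideal.Quotient.mk_surjective x
    rw [LinearMap.lTensor_tmul] at hx
    have h2 := congrArg (quotTensorEquivQuotSMul F₀ (Ideal.span {r})) hx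
    rw [map_zero, show (1 : R ⧸ (Ideal.span {r} : Ideal R)) = Ideal.Quotient.mk _ 1 from rfl,
      quotTensorEquivQuotSMul_mk_tmul, one_smul, Submodule.Quotient.mk_eq_zero,
      Submodule.ideal_span_singleton_smul] at h2
    obtain ⟨y, -, hy⟩ := h2
    replace hy : r • y = d₁ x := hy
    obtain ⟨z, rfl⟩ := (h₀ y).1 (hP _ (by rw [← map_smul, hy, h₀.apply_apply_eq_zero]))
    obtain ⟨w, hw⟩ := (h₁ (x - r • z)).1 (by rw [map_sub, map_smul, hy, sub_self])
    refine ⟨1 ⊗ₜ w, ?_⟩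
    rw [LinearMap.lTensor_tmul, hw, tmul_sub, tmul_smul, smul_tmul']
    have : r • (1 : R ⧸ (Ideal.span {r} : Ideal R)) = 0 := by
      rw [Algebra.smul_def, mul_one]
      exact Ideal.Quotient.eq_zero_iff_mem.2 (Ideal.mem_span_singleton_self r)
    rw [this, zero_tmul, sub_zero]
  · rintro ⟨y, rfl⟩
    exact LinearMap.congr_fun hcomp y

open TensorProduct in
theorem devHelper_exact_flat {R A : Type u} [CommRing R] [CommRing A] [Algebra R A]
    {F₂ F₁ F₀ : Type u} [AddCommGroup F₂] [Module R F₂] [AddCommGroup F₁] [Module R F₁]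
    [AddCommGroup F₀] [Module R F₀]
    (d₂ : F₂ →ₗ[R] F₁) (d₁ : F₁ →ₗ[R] F₀)
    (h : Function.Exact (d₂.lTensor A) (d₁.lTensor A))
    (Q : Type u) [AddCommGroup Q] [Module R Q] [Module A Q] [IsScalarTower R A Q]
    [Module.Flat A Q] :
    Function.Exact (d₂.lTensor Q) (d₁.lTensor Q) := by
  have h' : Function.Exact (AlgebraTensorModule.lTensor A A d₂)
      (AlgebraTensorModule.lTensor A A d₁) := h
  have h'' := Module.Flat.lTensor_exact (R := A) Q h'
  exact Function.Exact.of_ladder_linearEquiv_of_exact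
    (e₁ := AlgebraTensorModule.cancelBaseChange R A A Q F₂)
    (e₂ := AlgebraTensorModule.cancelBaseChange R A A Q F₁)
    (e₃ := AlgebraTensorModule.cancelBaseChange R A A Q F₀)
    (g₁₂ := AlgebraTensorModule.lTensor A Q d₂) (g₂₃ := AlgebraTensorModule.lTensor A Q d₁)
    (AlgebraTensorModule.lTensor_comp_cancelBaseChange R A A d₂)
    (AlgebraTensorModule.lTensor_comp_cancelBaseChange R A A d₁) h''

theorem devHelper_main {R : Type u} [CommRing R] (r : R) (N : ℕ)
    (M : Type u) [AddCommGroup M] [Module R M]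
    (hkill : ∀ x : M, r ^ N • x = 0) (hdev : HasFinProjMuDevissage r M)
    {F₂ F₁ F₀ P : Type u} [AddCommGroup F₂] [Module R F₂] [AddCommGroup F₁] [Module R F₁]
    [AddCommGroup F₀] [Module R F₀] [AddCommGroup P] [Module R P] [Module.Flat R F₀]
    (d₂ : F₂ →ₗ[R] F₁) (d₁ : F₁ →ₗ[R] F₀) (π : F₀ →ₗ[R] P)
    (h₁ : Function.Exact d₂ d₁) (h₀ : Function.Exact d₁ π)
    (hP : ∀ x : P, r • x = 0 → x = 0) :
    Function.Exact (d₂.lTensor M) (d₁.lTensor M) := by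
  have hq : ∀ n, Function.Exact (d₂.lTensor (muQuotSub r M n)) (d₁.lTensor (muQuotSub r M n)) := by
    intro n
    letI := (muQuotSub_isTorsionBySet r M n).module
    haveI : IsScalarTower R (R ⧸ (Ideal.span {r} : Ideal R)) (muQuotSub r M n) :=
      (muQuotSub_isTorsionBySet r M n).isScalarTower
    haveI : Module.Projective (R ⧸ (Ideal.span {r} : Ideal R)) (muQuotSub r M n) := (hdev n).2.1
    exact devHelper_exact_flat (A := R ⧸ (Ideal.span {r} : Ideal R)) d₂ d₁
      (devHelper_exact_quot r d₂ d₁ π h₁ h₀ hP) _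
  have hle : ∀ n, r ^ (n + 1) • (⊤ : Submodule R M) ≤ r ^ n • (⊤ : Submodule R M) := by
    rintro n _ ⟨m, -, rfl⟩
    refine ⟨r • m, trivial, ?_⟩
    show r ^ n • r • m = r ^ (n + 1) • m
    rw [smul_smul, pow_succ]
  have hstep : ∀ k n, n + k = N →
      Function.Exact (d₂.lTensor ↥(r ^ n • (⊤ : Submodule R M)))
        (d₁.lTensor ↥(r ^ n • (⊤ : Submodule R M))) := by
    intro k
    induction k with
    | zero =>
      intro n hn
      obtain rfl : n = N := by omega
      haveI : Subsingleton ↥(r ^ n • (⊤ : Submodule R M)) := by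
        refine ⟨?_⟩
        have : ∀ a : ↥(r ^ n • (⊤ : Submodule R M)), a = 0 := by
          rintro ⟨_, m, -, rfl⟩
          exact Subtype.ext (hkill m)
        intro a b
        rw [this a, this b]
      intro x
      exact ⟨fun _ => ⟨0, Subsingleton.elim _ _⟩, fun _ => Subsingleton.elim _ _⟩
    | succ k ih =>
      intro n hn
      have hmem : ∀ x : ↥(r ^ n • (⊤ : Submodule R M)),
          ((r ^ (n + 1) • (⊤ : Submodule R M)).mkQ ∘ₗ
            (r ^ n • (⊤ : Submodule R M)).subtype) x ∈ muQuotSub r M n :=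
        fun x => Submodule.mem_map_of_mem x.2
      refine devHelper_exact_ext d₂ d₁ h₁.apply_apply_eq_zero
        (Submodule.inclusion (hle n))
        (LinearMap.codRestrict (muQuotSub r M n) _ hmem)
        (Submodule.inclusion_injective _) ?_ ?_ (ih (n + 1) (by omega)) (hq n)
      · intro x
        have hx0 : LinearMap.codRestrict (muQuotSub r M n) _ hmem x = 0 ↔
            (x : M) ∈ r ^ (n + 1) • (⊤ : Submodule R M) := by
          rw [← Submodule.Quotient.mk_eq_zero, ← Subtype.coe_inj]
          rfl
        rw [hx0]
        constructor
        · intro h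
          exact ⟨⟨x, h⟩, rfl⟩
        · rintro ⟨y, rfl⟩
          exact y.2
      · rintro ⟨_, m, hm, rfl⟩
        exact ⟨⟨m, hm⟩, rfl⟩
  have h0 := hstep N 0 (by omega)
  have htop : r ^ 0 • (⊤ : Submodule R M) = ⊤ := by simp
  rw [htop] at h0
  refine Function.Exact.of_ladder_linearEquiv_of_exact
    (e₁ := TensorProduct.congr Submodule.topEquiv (LinearEquiv.refl R F₂))
    (e₂ := TensorProduct.congr Submodule.topEquiv (LinearEquiv.refl R F₁))
    (e₃ := TensorProduct.congr Submodule.topEquiv (LinearEquiv.refl R F₀)) ?_ ?_ h0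
  · ext; simp
  · ext; simp

open CategoryTheory in
/-- Lemma `tor_torsion_gen`: for a dévissage setup `(R,r)`, `N ≥ 1` and an
`R`-module `M` killed by `r^N` with finite projective `(r,μ)`-dévissage, `Tor₁^R(M,P)` vanishes
for every `r`-torsion-free `R`-module `P`. -/
theorem tor_one_vanishing_of_torsion {R : Type u} [CommRing R] (r : R)
    (hR : IsDevissageSetup R r) (N : ℕ) (hN : 1 ≤ N)
    (M : Type u) [AddCommGroup M] [Module R M]
    (hkill : ∀ x : M, r ^ N • x = 0) (hdev : HasFinProjMuDevissage r M)
    (P : Type u) [AddCommGroup P] [Module R P] (hP : ∀ x : P, r • x = 0 → x = 0) :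
    Limits.IsZero (((Tor (ModuleCat.{u} R) 1).obj (ModuleCat.of R M)).obj (ModuleCat.of R P)) := by
  let Q := projectiveResolution (ModuleCat.of R P)
  refine Limits.IsZero.of_iso ?_ (Q.isoLeftDerivedObj
    ((MonoidalCategory.tensoringLeft (ModuleCat.{u} R)).obj (ModuleCat.of R M)) 1)
  refine (HomologicalComplex.exactAt_iff_isZero_homology _ _).1 ?_
  rw [HomologicalComplex.exactAt_iff' _ 2 1 0 (by simp) (by simp),
    ShortComplex.ShortExact.moduleCat_exact_iff_function_exact]
  have h₁ := (ShortComplex.ShortExact.moduleCat_exact_iff_function_exact _).1 (Q.exact_succ 0)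
  have h₀ := (ShortComplex.ShortExact.moduleCat_exact_iff_function_exact _).1 Q.exact₀
  haveI : Module.Projective R (Q.complex.X 0) :=
    (IsProjective.iff_projective (R := R) (Q.complex.X 0)).2 (Q.projective 0)
  exact devHelper_main r N M hkill hdev (Q.complex.d 2 1).hom (Q.complex.d 1 0).hom
    (Q.π.f 0).hom h₁ h₀ hP
end

section
/- Let (R, r) be a dévissage setup such that every finitely generated projective R/rR-module is stably free. Then for every R-module M, the following are equivalent: (a) M is finitely presented with finite projective (r,μ)-dévissage and bounded r^∞-torsion; (b) there exist N ≥ 1, a finitely generated projective R-module M∞ of constant rank, and for each 1 ≤ n ≤ N a finitely generated projective R/rⁿR-module Mₙ of constant rank, together with an R-module isomorphism M ≅ M∞ ⊕ (⊕_{1 ≤ n ≤ N} Mₙ). -/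
open Pointwise

universe u

set_option linter.style.haveILetI false

/-! ### Stably free modules -/

theorem constRank_of_stablyFree {B : Type u} [CommRing B] {Q : Type u} [AddCommGroup Q] [Module B Q]
    {k d : ℕ} (e : (Q × (Fin k → B)) ≃ₗ[B] (Fin d → B)) : FinProjConstRank B Q := by
  have hfin : Module.Finite B Q :=
    Module.Finite.of_surjective (LinearMap.fst B Q (Fin k → B) ∘ₗ e.symm.toLinearMap)
      (Prod.fst_surjective.comp e.symm.surjective)
  have hproj : Module.Projective B Q := by
    refine Module.Projective.of_split (e.toLinearMap ∘ₗ LinearMap.inl B Q (Fin k → B))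
      (LinearMap.fst B Q (Fin k → B) ∘ₗ e.symm.toLinearMap) ?_
    ext x
    simp
  refine ⟨hfin, hproj, d - k, fun p hp => ?_⟩
  have : Module.Free (Localization.AtPrime p) (LocalizedModule p.primeCompl Q) :=
    Module.free_of_flat_of_isLocalRing
  have hnt : Nontrivial B := 
    ⟨0, 1, fun h => hp.ne_top ((Ideal.eq_top_iff_one p).2 (h ▸ p.zero_mem))⟩
  have h1 := congrFun (Module.rankAtStalk_eq_of_equiv e) ⟨p, hp⟩
  rw [Module.rankAtStalk_prod] at h1
  simp only [Pi.add_apply, Module.rankAtStalk_eq_finrank_of_free] at h1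
  simp at h1
  have h2 : Module.finrank (Localization.AtPrime p) (LocalizedModule p.primeCompl Q) = d - k := by
    have : Module.rankAtStalk Q ⟨p, hp⟩ = d - k := by omega
    exact this
  refine ⟨LinearEquiv.ofFinrankEq _ _ ?_⟩
  rw [h2]; simp

/-- `Q` is an `R`-linear retract of `(R/I)^d`. -/
def RetQ {R : Type u} [CommRing R] (I : Ideal R) (Q : Type u) [AddCommGroup Q] [Module R Q] : Prop :=
  ∃ (d : ℕ) (i : Q →ₗ[R] (Fin d → R ⧸ I)) (s : (Fin d → R ⧸ I) →ₗ[R] Q), ∀ x, s (i x) = x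

section Ret

variable {R : Type u} [CommRing R] {I : Ideal R}
variable {Q : Type u} [AddCommGroup Q] [Module R Q] {Q' : Type u} [AddCommGroup Q'] [Module R Q']

theorem quot_surj (I : Ideal R) : Function.Surjective (algebraMap R (R ⧸ I)) :=
  Ideal.Quotient.mk_surjective

theorem RetQ.retract (h : RetQ I Q) (i : Q' →ₗ[R] Q) (s : Q →ₗ[R] Q') (his : ∀ x, s (i x) = x) :
    RetQ I Q' := by
  obtain ⟨d, i', s', h'⟩ := h
  exact ⟨d, i' ∘ₗ i, s ∘ₗ s', fun x => by simp [h', his]⟩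

theorem RetQ.of_fintype {ι : Type*} [Fintype ι] (i : Q →ₗ[R] (ι → R ⧸ I))
    (s : (ι → R ⧸ I) →ₗ[R] Q) (h : ∀ x, s (i x) = x) : RetQ I Q := by
  let e : (ι → R ⧸ I) ≃ₗ[R] (Fin (Fintype.card ι) → R ⧸ I) :=
    LinearEquiv.funCongrLeft R (R ⧸ I) (Fintype.equivFin ι).symm
  exact ⟨_, e.toLinearMap ∘ₗ i, s ∘ₗ e.symm.toLinearMap, fun x => by simp [h]⟩

theorem RetQ.torsion (h : RetQ I Q) : Module.IsTorsionBySet R Q (I : Set R) := by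
  obtain ⟨d, i, s, his⟩ := h
  rintro x ⟨a, ha⟩
  show a • x = 0
  rw [← his x, ← map_smul]
  have : a • i x = 0 := by
    ext j
    obtain ⟨b, hb⟩ := Ideal.Quotient.mk_surjective (i x j)
    rw [Pi.smul_apply, ← hb]
    show Ideal.Quotient.mk I (a * b) = 0
    exact Ideal.Quotient.eq_zero_iff_mem.mpr (I.mul_mem_right _ ha)
  rw [this, map_zero]

theorem RetQ.finite_proj (h : RetQ I Q) (ht : Module.IsTorsionBySet R Q (I : Set R)) :
    letI := ht.module
    Module.Finite (R ⧸ I) Q ∧ Module.Projective (R ⧸ I) Q := by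
  letI := ht.module
  haveI : IsScalarTower R (R ⧸ I) Q := ht.isScalarTower
  obtain ⟨d, i, s, his⟩ := h
  constructor
  · exact Module.Finite.of_surjective (s.extendScalarsOfSurjective (quot_surj I))
      (fun x => ⟨i x, his x⟩)
  · exact Module.Projective.of_split (i.extendScalarsOfSurjective (quot_surj I))
      (s.extendScalarsOfSurjective (quot_surj I)) (LinearMap.ext his)

theorem RetQ.of_finite_proj (ht : Module.IsTorsionBySet R Q (I : Set R))
    (h : letI := ht.module; Module.Finite (R ⧸ I) Q ∧ Module.Projective (R ⧸ I) Q) : RetQ I Q := by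
  letI := ht.module
  haveI : IsScalarTower R (R ⧸ I) Q := ht.isScalarTower
  obtain ⟨h1, h2⟩ := h
  obtain ⟨n, f, g, -, -, hfg⟩ := Module.Finite.exists_comp_eq_id_of_projective (R ⧸ I) Q
  exact ⟨n, g.restrictScalars R, f.restrictScalars R, fun x => LinearMap.congr_fun hfg x⟩

theorem stablyFree_finProjConstRank {k d : ℕ}
    (e : (Q × (Fin k → R ⧸ I)) ≃ₗ[R] (Fin d → R ⧸ I))
    (ht : Module.IsTorsionBySet R Q (I : Set R)) :
    letI := ht.module
    FinProjConstRank (R ⧸ I) Q := by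
  letI := ht.module
  haveI : IsScalarTower R (R ⧸ I) Q := ht.isScalarTower
  exact constRank_of_stablyFree (e.extendScalarsOfSurjective (quot_surj I))

theorem stablyFree_retQ {k d : ℕ}
    (e : (Q × (Fin k → R ⧸ I)) ≃ₗ[R] (Fin d → R ⧸ I)) : RetQ I Q :=
  ⟨d, e.toLinearMap ∘ₗ LinearMap.inl R Q _, LinearMap.fst R Q _ ∘ₗ e.symm.toLinearMap,
    fun x => by simp⟩

/-- Every finite projective module over `R/I` is stably free (frozen hypothesis). -/
abbrev HK0 (I : Ideal R) : Prop :=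
  ∀ (P : Type u) (_ : AddCommGroup P) (_ : Module (R ⧸ I) P),
      Module.Finite (R ⧸ I) P → Module.Projective (R ⧸ I) P →
      ∃ k d : ℕ, Nonempty ((P × (Fin k → R ⧸ I)) ≃ₗ[R ⧸ I] (Fin d → R ⧸ I))

theorem RetQ.stablyFree (hK0 : HK0 I) (h : RetQ I Q) :
    ∃ k d : ℕ, Nonempty ((Q × (Fin k → R ⧸ I)) ≃ₗ[R] (Fin d → R ⧸ I)) := by
  letI := h.torsion.module
  haveI : IsScalarTower R (R ⧸ I) Q := h.torsion.isScalarTower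
  obtain ⟨h1, h2⟩ := h.finite_proj h.torsion
  obtain ⟨k, d, ⟨e⟩⟩ := hK0 Q _ _ h1 h2
  exact ⟨k, d, ⟨e.restrictScalars R⟩⟩

theorem RetQ.ker (h : RetQ I Q) (h' : RetQ I Q') (t : Q →ₗ[R] Q') (ht : Function.Surjective t) :
    RetQ I (LinearMap.ker t) := by
  letI := h.torsion.module
  haveI : IsScalarTower R (R ⧸ I) Q := h.torsion.isScalarTower
  letI := h'.torsion.module
  haveI : IsScalarTower R (R ⧸ I) Q' := h'.torsion.isScalarTower
  obtain ⟨-, h2⟩ := h'.finite_proj h'.torsion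
  obtain ⟨σ, hσ⟩ := Module.projective_lifting_property
    (t.extendScalarsOfSurjective (quot_surj I)) (LinearMap.id : Q' →ₗ[R ⧸ I] Q') ht
  have hσ' : ∀ x, t (σ x) = x := fun x => LinearMap.congr_fun hσ x
  refine h.retract (LinearMap.ker t).subtype
    (LinearMap.codRestrict _ (LinearMap.id - (σ.restrictScalars R) ∘ₗ t) ?_) ?_
  · intro x
    simp [hσ']
  · rintro ⟨x, hx⟩
    rw [LinearMap.mem_ker] at hx
    apply Subtype.ext
    show x - σ (t x) = x
    rw [hx, map_zero, sub_zero]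

theorem RetQ.prod (h : RetQ I Q) (h' : RetQ I Q') : RetQ I (Q × Q') := by
  obtain ⟨d, i, s, his⟩ := h
  obtain ⟨d', i', s', his'⟩ := h'
  let e : ((Fin d ⊕ Fin d') → R ⧸ I) ≃ₗ[R] ((Fin d → R ⧸ I) × (Fin d' → R ⧸ I)) :=
    LinearEquiv.sumArrowLequivProdArrow _ _ _ _
  refine RetQ.of_fintype (ι := Fin d ⊕ Fin d') (e.symm.toLinearMap ∘ₗ (i.prodMap i'))
    ((s.prodMap s') ∘ₗ e.toLinearMap) ?_
  intro x
  simp [his, his']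

theorem RetQ.pi {ι : Type} [Fintype ι] {X : ι → Type u} [∀ i, AddCommGroup (X i)]
    [∀ i, Module R (X i)] (h : ∀ j, RetQ I (X j)) : RetQ I (∀ j, X j) := by
  choose d i s his using h
  let e : ((Σ j, Fin (d j)) → R ⧸ I) ≃ₗ[R] (∀ j, Fin (d j) → R ⧸ I) :=
    LinearEquiv.piCurry R (fun _ _ => R ⧸ I)
  refine RetQ.of_fintype (ι := Σ j, Fin (d j))
    (e.symm.toLinearMap ∘ₗ LinearMap.pi (fun j => i j ∘ₗ LinearMap.proj j))
    (LinearMap.pi (fun j => s j ∘ₗ LinearMap.proj j) ∘ₗ e.toLinearMap) ?_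
  intro x
  ext j
  simp [his]

end Ret

section Fil

variable {R : Type u} [CommRing R] (r : R)

/-- Elements `m` with `r^j m ∈ r^(j+1) M`. -/
def Fil (j : ℕ) (M : Type u) [AddCommGroup M] [Module R M] : Submodule R M where
  carrier := {m | ∃ m' : M, r ^ j • m = r ^ (j + 1) • m'}
  add_mem' := by
    rintro a b ⟨a', ha⟩ ⟨b', hb⟩
    exact ⟨a' + b', by rw [smul_add, smul_add, ha, hb]⟩
  zero_mem' := ⟨0, by simp⟩
  smul_mem' := by
    rintro c a ⟨a', ha⟩
    exact ⟨c • a', by rw [smul_comm, ha, smul_comm]⟩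

variable {M : Type u} [AddCommGroup M] [Module R M] {M' : Type u} [AddCommGroup M'] [Module R M']

theorem mem_Fil {j : ℕ} {m : M} : m ∈ Fil r j M ↔ ∃ m' : M, r ^ j • m = r ^ (j + 1) • m' := Iff.rfl

theorem smul_mem_Fil (j : ℕ) (m : M) : r • m ∈ Fil r j M :=
  ⟨m, by rw [smul_smul, ← pow_succ]⟩

theorem Fil_succ (j : ℕ) : Fil r j M ≤ Fil r (j + 1) M := by
  rintro m ⟨m', h⟩
  exact ⟨m', by rw [pow_succ', mul_smul, h, smul_smul, ← pow_succ']⟩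

theorem Fil_map (j : ℕ) (f : M →ₗ[R] M') : Fil r j M ≤ (Fil r j M').comap f := by
  rintro m ⟨m', h⟩
  exact ⟨f m', by rw [← map_smul, h, map_smul]⟩

/-- The map `m ↦ [r^j m]`. -/
def rhoMap (j : ℕ) (M : Type u) [AddCommGroup M] [Module R M] : M →ₗ[R] muQuotSub r M j :=
  LinearMap.codRestrict _ ((r ^ (j + 1) • (⊤ : Submodule R M)).mkQ ∘ₗ
    (LinearMap.lsmul R M (r ^ j))) (fun m => Submodule.mem_map_of_mem
      (Submodule.smul_mem_pointwise_smul _ _ _ Submodule.mem_top))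

theorem rhoMap_surj (j : ℕ) : Function.Surjective (rhoMap r j M) := by
  rintro ⟨x, hx⟩
  obtain ⟨m, hm, rfl⟩ := hx
  obtain ⟨m', -, rfl⟩ := hm
  exact ⟨m', rfl⟩

theorem rhoMap_ker (j : ℕ) : LinearMap.ker (rhoMap r j M) = Fil r j M := by
  ext m
  rw [LinearMap.mem_ker, ← Subtype.coe_inj]
  show (r ^ (j + 1) • (⊤ : Submodule R M)).mkQ (r ^ j • m) = 0 ↔ _
  rw [Submodule.mkQ_apply, Submodule.Quotient.mk_eq_zero, mem_Fil]
  constructor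
  · rintro ⟨m', -, h⟩
    exact ⟨m', h.symm⟩
  · rintro ⟨m', h⟩
    exact ⟨m', Submodule.mem_top, h.symm⟩

/-- `M / Fil ≃ μ_j(M)` -/
noncomputable def muEquiv (j : ℕ) : (M ⧸ Fil r j M) ≃ₗ[R] muQuotSub r M j :=
  (Submodule.quotEquivOfEq _ _ (rhoMap_ker r j).symm).trans
    ((rhoMap r j M).quotKerEquivOfSurjective (rhoMap_surj r j))

theorem retQ_of_devissage (h : HasFinProjMuDevissage r M) (j : ℕ) :
    RetQ (Ideal.span {r}) (M ⧸ Fil r j M) := by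
  have h1 : RetQ (Ideal.span {r}) (muQuotSub r M j) :=
    RetQ.of_finite_proj (muQuotSub_isTorsionBySet r M j) ⟨(h j).1, (h j).2.1⟩
  exact h1.retract (muEquiv r j).toLinearMap (muEquiv r j).symm.toLinearMap (fun x => by simp)

theorem devissage_of_retQ (hK0 : HK0 (Ideal.span {r}))
    (h : ∀ j, RetQ (Ideal.span {r}) (M ⧸ Fil r j M)) : HasFinProjMuDevissage r M := by
  intro j
  have h1 : RetQ (Ideal.span {r}) (muQuotSub r M j) :=
    (h j).retract (muEquiv r j).symm.toLinearMap (muEquiv r j).toLinearMap (fun x => by simp)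
  obtain ⟨k, d, ⟨e⟩⟩ := h1.stablyFree hK0
  exact stablyFree_finProjConstRank e _

/-- property that `μ_j` is finite projective -/
def DD (j : ℕ) (M : Type u) [AddCommGroup M] [Module R M] : Prop :=
  RetQ (Ideal.span {r}) (M ⧸ Fil r j M)

/-- functoriality -/
def filMap (j : ℕ) (f : M →ₗ[R] M') : (M ⧸ Fil r j M) →ₗ[R] (M' ⧸ Fil r j M') :=
  Submodule.mapQ _ _ f (Fil_map r j f)

variable {r}

theorem DD.retract {j : ℕ} (h : DD r j M) (i : M' →ₗ[R] M) (s : M →ₗ[R] M')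
    (his : ∀ x, s (i x) = x) : DD r j M' := by
  refine RetQ.retract h (filMap r j i) (filMap r j s) ?_
  intro x
  induction x using Submodule.Quotient.induction_on with
  | H x => simp [filMap, his]

theorem DD.prod {j : ℕ} (h : DD r j M) (h' : DD r j M') : DD r j (M × M') := by
  refine RetQ.retract (RetQ.prod h h')
    ((filMap r j (LinearMap.fst R M M')).prod (filMap r j (LinearMap.snd R M M')))
    ((filMap r j (LinearMap.inl R M M')).coprod (filMap r j (LinearMap.inr R M M'))) ?_
  intro x
  induction x using Submodule.Quotient.induction_on with
  | H x =>
    obtain ⟨x, y⟩ := x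
    simp [filMap, ← Submodule.Quotient.mk_add]

theorem DD.pi {j : ℕ} {ι : Type} [Fintype ι] {X : ι → Type u} [∀ i, AddCommGroup (X i)]
    [∀ i, Module R (X i)] (h : ∀ i, DD r j (X i)) : DD r j (∀ i, X i) := by
  classical
  refine RetQ.retract (RetQ.pi h)
    (LinearMap.pi (fun i => filMap r j (LinearMap.proj i)))
    (∑ i, filMap r j (LinearMap.single R X i) ∘ₗ LinearMap.proj i) ?_
  intro x
  induction x using Submodule.Quotient.induction_on with
  | H x =>
    simp only [LinearMap.sum_apply, LinearMap.comp_apply, LinearMap.proj_apply, LinearMap.pi_apply,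
      filMap, Submodule.mapQ_apply, LinearMap.single_apply]
    simp only [← Submodule.mkQ_apply]
    rw [← map_sum, Finset.univ_sum_single]

theorem RetQ.one {I : Ideal R} {Q : Type u} [AddCommGroup Q] [Module R Q] (e : Q ≃ₗ[R] R ⧸ I) :
    RetQ I Q :=
  RetQ.of_fintype (ι := Unit) (LinearMap.pi (fun _ => e.toLinearMap))
    (e.symm.toLinearMap ∘ₗ LinearMap.proj ()) (fun x => by simp)

theorem RetQ.zero {I : Ideal R} {Q : Type u} [AddCommGroup Q] [Module R Q] [Subsingleton Q] :
    RetQ I Q :=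
  ⟨0, 0, 0, fun x => Subsingleton.elim _ _⟩

theorem pow_torsionFree (ht : ∀ x : R, r * x = 0 → x = 0) (n : ℕ) {x : R} (h : r ^ n * x = 0) :
    x = 0 := by
  induction n with
  | zero => simpa using h
  | succ n ih => exact ih (ht _ (by rw [← h]; ring))

theorem DD.self (ht : ∀ x : R, r * x = 0 → x = 0) (j : ℕ) : DD r j R := by
  refine RetQ.one (Submodule.quotEquivOfEq _ _ ?_)
  ext x
  rw [mem_Fil, Ideal.mem_span_singleton']
  constructor
  · rintro ⟨y, h⟩
    refine ⟨y, ?_⟩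
    have : r ^ j * (x - r * y) = 0 := by
      simp only [smul_eq_mul] at h
      rw [mul_sub, h]; ring
    have := pow_torsionFree ht j this
    linear_combination -this
  · rintro ⟨y, rfl⟩
    exact ⟨y, by simp only [smul_eq_mul]; ring⟩

theorem DD.quot (ht : ∀ x : R, r * x = 0 → x = 0) (j n : ℕ) :
    DD r j (R ⧸ (Ideal.span {r ^ n} : Ideal R)) := by
  set I : Ideal R := Ideal.span {r ^ n}
  by_cases hj : n ≤ j
  · have : Subsingleton ((R ⧸ I) ⧸ Fil r j (R ⧸ I)) := by
      rw [Submodule.Quotient.subsingleton_iff, eq_top_iff]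
      intro x _
      refine ⟨0, ?_⟩
      obtain ⟨b, rfl⟩ := Ideal.Quotient.mk_surjective x
      rw [smul_zero]
      show Ideal.Quotient.mk I (r ^ j * b) = 0
      rw [Ideal.Quotient.eq_zero_iff_mem, Ideal.mem_span_singleton]
      exact (pow_dvd_pow r hj).mul_right b
    exact RetQ.zero
  · let f : R →ₗ[R] (R ⧸ I) ⧸ Fil r j (R ⧸ I) := (Fil r j (R ⧸ I)).mkQ ∘ₗ I.mkQ
    have hf : Function.Surjective f :=
      (Submodule.mkQ_surjective _).comp (Submodule.mkQ_surjective _)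
    have hk : LinearMap.ker f = Ideal.span {r} := by
      ext x
      rw [LinearMap.mem_ker]
      show (Fil r j (R ⧸ I)).mkQ (I.mkQ x) = 0 ↔ _
      rw [Submodule.mkQ_apply, Submodule.Quotient.mk_eq_zero, mem_Fil, Ideal.mem_span_singleton]
      constructor
      · rintro ⟨y, h⟩
        obtain ⟨y, rfl⟩ := Ideal.Quotient.mk_surjective y
        have h : Ideal.Quotient.mk I (r ^ j * x) = Ideal.Quotient.mk I (r ^ (j + 1) * y) := h
        rw [Ideal.Quotient.eq, Ideal.mem_span_singleton] at h
        obtain ⟨z, hz⟩ := h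
        obtain ⟨l, rfl⟩ : ∃ l, n = j + 1 + l := ⟨n - (j + 1), by omega⟩
        have : r ^ j * (x - r * (y + r ^ l * z)) = 0 := by
          linear_combination hz
        have := pow_torsionFree ht j this
        exact ⟨y + r ^ l * z, by linear_combination this⟩
      · rintro ⟨y, rfl⟩
        refine ⟨I.mkQ y, ?_⟩
        rw [← map_smul, ← map_smul]
        congr 1
        simp only [smul_eq_mul]; ring
    exact RetQ.one ((f.quotKerEquivOfSurjective hf).symm.trans (Submodule.quotEquivOfEq _ _ hk))

end Fil

theorem finitePresentation_retract {R : Type u} [CommRing R] {M M' : Type u} [AddCommGroup M]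
    [Module R M] [AddCommGroup M'] [Module R M'] [Module.FinitePresentation R M]
    (i : M' →ₗ[R] M) (s : M →ₗ[R] M') (his : ∀ x, s (i x) = x) :
    Module.FinitePresentation R M' := by
  refine Module.finitePresentation_of_surjective s (fun x => ⟨i x, his x⟩) ?_
  have : LinearMap.ker s = LinearMap.range (LinearMap.id - i ∘ₗ s) := by
    ext x
    constructor
    · intro hx
      rw [LinearMap.mem_ker] at hx
      exact ⟨x, by simp [hx]⟩
    · rintro ⟨y, rfl⟩
      simp [his]
  rw [this, LinearMap.range_eq_map]
  exact Module.Finite.fg_top.map _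

theorem finitePresentation_quot {R : Type u} [CommRing R] (s : R) :
    Module.FinitePresentation R (R ⧸ (Ideal.span {s} : Ideal R)) := by
  refine Module.finitePresentation_of_surjective (Submodule.mkQ (Ideal.span {s}))
    (Submodule.mkQ_surjective _) ?_
  rw [Submodule.ker_mkQ]
  exact ⟨{s}, by simp [Ideal.span]⟩

theorem backward {R : Type u} [CommRing R] (r : R)
    (hR : IsDevissageSetup R r) (hK0 : HK0 (Ideal.span {r}))
    (M : Type u) [AddCommGroup M] [Module R M] (N : ℕ) (hN : 1 ≤ N)
    (Minf : Type u) [AddCommGroup Minf] [Module R Minf] (hinf : FinProjConstRank R Minf)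
    (Mn : Fin N → Type u) [∀ i, AddCommGroup (Mn i)] [∀ i, Module R (Mn i)]
    (hMn : ∀ i : Fin N, RetQ (Ideal.span {r ^ ((i : ℕ) + 1)}) (Mn i))
    (e : M ≃ₗ[R] (Minf × ((i : Fin N) → Mn i))) :
    Module.FinitePresentation R M ∧ HasFinProjMuDevissage r M ∧ BoundedRTorsion r M := by
  obtain ⟨h1, h2, -⟩ := hinf
  obtain ⟨d, f, g, -, -, hfg⟩ := Module.Finite.exists_comp_eq_id_of_projective R Minf
  have hfg' : ∀ x, f (g x) = x := fun x => LinearMap.congr_fun hfg x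
  refine ⟨?_, ?_, ?_⟩
  · have : ∀ i, Module.FinitePresentation R (Mn i) := fun i => by
      obtain ⟨d, a, b, hab⟩ := hMn i
      have := finitePresentation_quot (r ^ ((i : ℕ) + 1))
      exact finitePresentation_retract a b hab
    have := Module.finitePresentation_of_projective R Minf
    exact Module.FinitePresentation.of_equiv e.symm
  · refine devissage_of_retQ r hK0 (fun j => ?_)
    have hD1 : DD r j Minf :=
      (DD.pi (ι := Fin d) (X := fun _ => R) (fun _ => DD.self hR.torsionFree j)).retract g f hfg'
    have hD2 : ∀ i, DD r j (Mn i) := fun i => by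
      obtain ⟨d, a, b, hab⟩ := hMn i
      exact (DD.pi (ι := Fin d) (fun _ => DD.quot hR.torsionFree j _)).retract a b hab
    exact (hD1.prod (DD.pi hD2)).retract e.toLinearMap e.symm.toLinearMap (fun x => by simp)
  · refine ⟨N, hN, ?_⟩
    rintro x ⟨k, hk⟩
    apply e.injective
    rw [map_smul, map_zero]
    have hk' : r ^ k • e x = 0 := by rw [← map_smul, hk, map_zero]
    ext1
    · have h3 : r ^ k • g (e x).1 = 0 := by
        rw [← map_smul, ← Prod.smul_fst, hk', Prod.fst_zero, map_zero]
      have h4 : g (e x).1 = 0 := by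
        ext j
        exact pow_torsionFree hR.torsionFree k (congrFun h3 j)
      have : (e x).1 = 0 := by rw [← hfg' (e x).1, h4, map_zero]
      simp [this]
    · ext i
      have := (Module.isTorsionBySet_span_singleton_iff _).1 (hMn i).torsion (x := (e x).2 i)
      show r ^ N • (e x).2 i = 0
      obtain ⟨l, hl⟩ : ∃ l, N = l + ((i : ℕ) + 1) := ⟨N - (i + 1), by omega⟩
      have hp : r ^ N = r ^ l * r ^ ((i : ℕ) + 1) := by rw [← pow_add, ← hl]
      rw [hp, mul_smul]
      rw [this, smul_zero]

section Forward

variable {R : Type u} [CommRing R] {r : R}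

theorem surj_of_mod (hR : IsDevissageSetup R r) {X Y : Type u} [AddCommGroup X] [Module R X]
    [AddCommGroup Y] [Module R Y] [Module.Finite R Y] (f : X →ₗ[R] Y)
    (h : ∀ y, ∃ x y', y - f x = r • y') : Function.Surjective f := by
  haveI := hR.adicComplete
  rw [← LinearMap.range_eq_top, eq_top_iff]
  refine Submodule.le_of_le_smul_of_le_jacobson_bot (I := Ideal.span {r}) Module.Finite.fg_top
    (IsAdicComplete.le_jacobson_bot _) ?_
  intro y _
  obtain ⟨x, y', hy⟩ := h y
  rw [sub_eq_iff_eq_add'] at hy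
  rw [hy]
  exact Submodule.add_mem_sup ⟨x, rfl⟩
    (Submodule.smul_mem_smul (Ideal.mem_span_singleton_self r) Submodule.mem_top)

theorem mk_pi_eq_zero {d : ℕ} {x : Fin d → R}
    (h : ∀ j, Ideal.Quotient.mk (Ideal.span {r}) (x j) = 0) : ∃ y, x = r • y := by
  have : ∀ j, ∃ y, x j = r * y := fun j => by
    have := h j
    rwa [Ideal.Quotient.eq_zero_iff_mem, Ideal.mem_span_singleton] at this
  choose y hy using this
  exact ⟨y, funext hy⟩

/-- Lifting a stably free module along `R → R/r`. -/
theorem exists_lift (hR : IsDevissageSetup R r) (hK0 : HK0 (Ideal.span {r}))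
    {K : Type u} [AddCommGroup K] [Module R K] (hK : RetQ (Ideal.span {r}) K) :
    ∃ (P : Type u) (_ : AddCommGroup P) (_ : Module R P) (k d : ℕ)
      (_ : (P × (Fin k → R)) ≃ₗ[R] (Fin d → R)) (π : P →ₗ[R] K),
      Function.Surjective π ∧ ∀ p, π p = 0 → ∃ p', p = r • p' := by
  obtain ⟨k, d, ⟨e⟩⟩ := hK.stablyFree hK0
  let I : Ideal R := Ideal.span {r}
  let qd : (Fin d → R) →ₗ[R] (Fin d → R ⧸ I) := LinearMap.pi (fun j => I.mkQ ∘ₗ LinearMap.proj j)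
  let qk : (Fin k → R) →ₗ[R] (Fin k → R ⧸ I) := LinearMap.pi (fun j => I.mkQ ∘ₗ LinearMap.proj j)
  have hqd : Function.Surjective qd := fun y => by
    choose x hx using fun j => Ideal.Quotient.mk_surjective (y j)
    exact ⟨x, funext hx⟩
  have hqk : Function.Surjective qk := fun y => by
    choose x hx using fun j => Ideal.Quotient.mk_surjective (y j)
    exact ⟨x, funext hx⟩
  have hqd0 : ∀ x, qd x = 0 → ∃ y, x = r • y := fun x h => mk_pi_eq_zero (fun j => congrFun h j)
  have hqk0 : ∀ x, qk x = 0 → ∃ y, x = r • y := fun x h => mk_pi_eq_zero (fun j => congrFun h j)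
  obtain ⟨g, hg⟩ := Module.projective_lifting_property qk
    (LinearMap.snd R K _ ∘ₗ e.symm.toLinearMap ∘ₗ qd) hqk
  have hg' : ∀ x, qk (g x) = (e.symm (qd x)).2 := fun x => LinearMap.congr_fun hg x
  have hgs : Function.Surjective g := by
    refine surj_of_mod hR g (fun y => ?_)
    obtain ⟨x, hx⟩ := hqd (e (0, qk y))
    obtain ⟨y', hy'⟩ := hqk0 (y - g x) (by rw [map_sub, hg', hx]; simp)
    exact ⟨x, y', hy'⟩
  obtain ⟨σ, hσ⟩ := Module.projective_lifting_property g LinearMap.id hgs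
  have hσ' : ∀ x, g (σ x) = x := fun x => LinearMap.congr_fun hσ x
  let eq : (LinearMap.ker g × (Fin k → R)) ≃ₗ[R] (Fin d → R) :=
    LinearEquiv.ofBijective ((LinearMap.ker g).subtype.coprod σ) (by
      constructor
      · rw [← LinearMap.ker_eq_bot, LinearMap.ker_eq_bot']
        rintro ⟨⟨p, hp⟩, y⟩ h
        rw [LinearMap.mem_ker] at hp
        have h : p + σ y = 0 := h
        have hy : y = 0 := by
          have := congrArg g h
          rwa [map_add, hp, hσ', zero_add, map_zero] at this
        subst hy
        rw [map_zero, add_zero] at h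
        subst h
        rfl
      · intro x
        refine ⟨(⟨x - σ (g x), by rw [LinearMap.mem_ker, map_sub, hσ', sub_self]⟩, g x), ?_⟩
        show x - σ (g x) + σ (g x) = x
        abel)
  refine ⟨LinearMap.ker g, inferInstance, inferInstance, k, d, eq,
    LinearMap.fst R K _ ∘ₗ e.symm.toLinearMap ∘ₗ qd ∘ₗ (LinearMap.ker g).subtype, ?_, ?_⟩
  · intro q
    obtain ⟨x, hx⟩ := hqd (e (q, 0))
    obtain ⟨y', hy'⟩ := hqk0 (g x) (by rw [hg', hx]; simp)
    obtain ⟨y, rfl⟩ := hgs y'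
    refine ⟨⟨x - r • y, by rw [LinearMap.mem_ker, map_sub, map_smul, hy', sub_self]⟩, ?_⟩
    show (e.symm (qd (x - r • y))).1 = q
    have : qd (r • y) = 0 := by
      ext j
      show Ideal.Quotient.mk I (r * y j) = 0
      rw [Ideal.Quotient.eq_zero_iff_mem]
      exact I.mul_mem_right _ (Ideal.mem_span_singleton_self r)
    rw [map_sub, this, sub_zero, hx]
    simp
  · rintro ⟨x, hx⟩ h
    rw [LinearMap.mem_ker] at hx
    have h1 : (e.symm (qd x)).1 = 0 := h
    have h2 : (e.symm (qd x)).2 = 0 := by rw [← hg', hx, map_zero]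
    have h3 : qd x = 0 := by
      rw [← e.symm.map_eq_zero_iff]
      exact Prod.ext h1 h2
    obtain ⟨y, rfl⟩ := hqd0 x h3
    refine ⟨⟨y, ?_⟩, rfl⟩
    rw [LinearMap.mem_ker]
    rw [map_smul] at hx
    ext j
    exact hR.torsionFree _ (congrFun hx j)

theorem proj_of_sf {P : Type u} [AddCommGroup P] [Module R P] {k d : ℕ}
    (e : (P × (Fin k → R)) ≃ₗ[R] (Fin d → R)) : Module.Projective R P :=
  (constRank_of_stablyFree e).2.1

theorem separated_of_sf (hR : IsDevissageSetup R r) {P : Type u} [AddCommGroup P] [Module R P]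
    {k d : ℕ} (e : (P × (Fin k → R)) ≃ₗ[R] (Fin d → R)) (p : P)
    (hp : ∀ n : ℕ, ∃ q, p = r ^ n • q) : p = 0 := by
  haveI := hR.adicComplete
  have h0 : e (p, 0) = 0 := by
    ext j
    apply IsHausdorff.haus (I := Ideal.span {r}) (M := R) inferInstance
    intro n
    obtain ⟨q, rfl⟩ := hp n
    have : ((r ^ n • q, 0) : P × (Fin k → R)) = r ^ n • (q, 0) := by simp
    rw [this, map_smul, SModEq.zero, Ideal.span_singleton_pow]
    simp only [Pi.smul_apply]
    exact Submodule.smul_mem_smul (Ideal.mem_span_singleton_self _) Submodule.mem_top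
  have := (e.map_eq_zero_iff).1 h0
  exact congrArg Prod.fst this

variable {M : Type u} [AddCommGroup M] [Module R M]

/-- the free part -/
theorem exists_inf (hR : IsDevissageSetup R r) (hK0 : HK0 (Ideal.span {r}))
    (hM : ∀ j, RetQ (Ideal.span {r}) (M ⧸ Fil r j M)) (N : ℕ) :
    ∃ (P : Type u) (_ : AddCommGroup P) (_ : Module R P) (k d : ℕ)
      (_ : (P × (Fin k → R)) ≃ₗ[R] (Fin d → R)) (φ : P →ₗ[R] M),
      (∀ p, φ p ∈ Fil r N M → ∃ p', p = r • p') ∧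
      (∀ m, ∃ p, m - φ p ∈ Fil r N M) := by
  obtain ⟨P, _, _, k, d, e, π, hπ, hk⟩ := exists_lift hR hK0 (hM N)
  have := proj_of_sf e
  obtain ⟨φ, hφ⟩ := Module.projective_lifting_property (Fil r N M).mkQ π
    (Submodule.mkQ_surjective _)
  have hφ' : ∀ p, (Fil r N M).mkQ (φ p) = π p := fun x => LinearMap.congr_fun hφ x
  refine ⟨P, _, _, k, d, e, φ, fun p hp => hk p ?_, fun m => ?_⟩
  · rw [← hφ', Submodule.mkQ_apply, Submodule.Quotient.mk_eq_zero]
    exact hp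
  · obtain ⟨p, hp⟩ := hπ ((Fil r N M).mkQ m)
    refine ⟨p, ?_⟩
    rw [← Submodule.Quotient.mk_eq_zero, ← Submodule.mkQ_apply, map_sub, hφ', hp, sub_self]

/-- Reduction modulo `s` of a stably free module. -/
theorem exists_red (s : R) {P : Type u} [AddCommGroup P] [Module R P] {k d : ℕ}
    (e : (P × (Fin k → R)) ≃ₗ[R] (Fin d → R)) :
    Nonempty (((P ⧸ LinearMap.range (LinearMap.lsmul R P s)) ×
      (Fin k → R ⧸ (Ideal.span {s} : Ideal R))) ≃ₗ[R] (Fin d → R ⧸ (Ideal.span {s} : Ideal R))) := by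
  let I : Ideal R := Ideal.span {s}
  let S := LinearMap.range (LinearMap.lsmul R P s)
  let qd : (Fin d → R) →ₗ[R] (Fin d → R ⧸ I) := LinearMap.pi (fun j => I.mkQ ∘ₗ LinearMap.proj j)
  let qk : (Fin k → R) →ₗ[R] (Fin k → R ⧸ I) := LinearMap.pi (fun j => I.mkQ ∘ₗ LinearMap.proj j)
  have hqd : Function.Surjective qd := fun y => by
    choose x hx using fun j => Ideal.Quotient.mk_surjective (y j)
    exact ⟨x, funext hx⟩
  have hqk : Function.Surjective qk := fun y => by
    choose x hx using fun j => Ideal.Quotient.mk_surjective (y j)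
    exact ⟨x, funext hx⟩
  have hqd0 : ∀ x, qd x = 0 ↔ ∃ y, x = s • y := fun x => by
    refine ⟨fun h => mk_pi_eq_zero (fun j => congrFun h j), ?_⟩
    rintro ⟨y, rfl⟩
    ext j
    show Ideal.Quotient.mk I (s * y j) = 0
    rw [Ideal.Quotient.eq_zero_iff_mem]
    exact I.mul_mem_right _ (Ideal.mem_span_singleton_self s)
  have hqk0 : ∀ x, qk x = 0 ↔ ∃ y, x = s • y := fun x => by
    refine ⟨fun h => mk_pi_eq_zero (fun j => congrFun h j), ?_⟩
    rintro ⟨y, rfl⟩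
    ext j
    show Ideal.Quotient.mk I (s * y j) = 0
    rw [Ideal.Quotient.eq_zero_iff_mem]
    exact I.mul_mem_right _ (Ideal.mem_span_singleton_self s)
  let f1 : (P × (Fin k → R)) →ₗ[R] ((P ⧸ S) × (Fin k → R ⧸ I)) := S.mkQ.prodMap qk
  let f2 : (P × (Fin k → R)) →ₗ[R] (Fin d → R ⧸ I) := qd ∘ₗ e.toLinearMap
  have h1 : Function.Surjective f1 := (Submodule.mkQ_surjective S).prodMap hqk
  have h2 : Function.Surjective f2 := hqd.comp e.surjective
  have hk : LinearMap.ker f1 = LinearMap.ker f2 := by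
    ext x
    rw [LinearMap.mem_ker, LinearMap.mem_ker]
    show (S.mkQ x.1, qk x.2) = 0 ↔ qd (e x) = 0
    rw [hqd0, Prod.mk_eq_zero, hqk0, Submodule.mkQ_apply, Submodule.Quotient.mk_eq_zero]
    constructor
    · rintro ⟨⟨p, hp⟩, ⟨y, hy⟩⟩
      refine ⟨e (p, y), ?_⟩
      rw [← map_smul]
      congr 1
      exact Prod.ext hp.symm hy
    · rintro ⟨y, hy⟩
      have : x = s • e.symm y := by rw [← map_smul, ← hy]; simp
      exact ⟨⟨(e.symm y).1, by rw [this]; rfl⟩, ⟨(e.symm y).2, by rw [this]; rfl⟩⟩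
  exact ⟨(f1.quotKerEquivOfSurjective h1).symm.trans
    ((Submodule.quotEquivOfEq _ _ hk).trans (f2.quotKerEquivOfSurjective h2))⟩

/-- the torsion pieces -/
theorem exists_piece (hR : IsDevissageSetup R r) (hK0 : HK0 (Ideal.span {r}))
    (hM : ∀ j, RetQ (Ideal.span {r}) (M ⧸ Fil r j M)) (n : ℕ) :
    ∃ (Q : Type u) (_ : AddCommGroup Q) (_ : Module R Q) (k d : ℕ)
      (_ : (Q × (Fin k → R ⧸ (Ideal.span {r ^ (n + 1)} : Ideal R))) ≃ₗ[R]
        (Fin d → R ⧸ (Ideal.span {r ^ (n + 1)} : Ideal R))) (φ : Q →ₗ[R] M),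
      (∀ q : Q, r ^ (n + 1) • q = 0) ∧
      (∀ q, φ q ∈ Fil r n M → ∃ q', q = r • q') ∧
      (∀ m ∈ Fil r (n + 1) M, ∃ q, m - φ q ∈ Fil r n M) := by
  let t : (M ⧸ Fil r n M) →ₗ[R] (M ⧸ Fil r (n + 1) M) :=
    Submodule.mapQ _ _ LinearMap.id (Fil_succ r n)
  have ht : Function.Surjective t := fun x => by
    induction x using Submodule.Quotient.induction_on with
    | H x => exact ⟨(Fil r n M).mkQ x, rfl⟩
  obtain ⟨P, _, _, k, d, e, π, hπ, hk⟩ := exists_lift hR hK0 ((hM n).ker (hM (n + 1)) t ht)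
  have := proj_of_sf e
  let T : Submodule R M := LinearMap.ker (LinearMap.lsmul R M (r ^ (n + 1)))
  have hT : ∀ m, m ∈ T ↔ r ^ (n + 1) • m = 0 := fun m => Iff.rfl
  have hkt : ∀ m : M, (Fil r n M).mkQ m ∈ LinearMap.ker t ↔ m ∈ Fil r (n + 1) M := fun m => by
    rw [LinearMap.mem_ker]
    exact Submodule.Quotient.mk_eq_zero _
  let u : T →ₗ[R] LinearMap.ker t :=
    LinearMap.codRestrict _ ((Fil r n M).mkQ ∘ₗ T.subtype) (fun m => (hkt _).2
      ⟨0, by rw [smul_zero]; exact m.2⟩)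
  have hu : Function.Surjective u := by
    rintro ⟨x, hx⟩
    induction x using Submodule.Quotient.induction_on with
    | H m =>
      obtain ⟨m', hm⟩ := (hkt m).1 hx
      refine ⟨⟨m - r • m', ?_⟩, ?_⟩
      · rw [hT, smul_sub, hm, smul_smul, ← pow_succ, sub_self]
      · apply Subtype.ext
        show (Fil r n M).mkQ (m - r • m') = (Fil r n M).mkQ m
        rw [map_sub, sub_eq_self, Submodule.mkQ_apply, Submodule.Quotient.mk_eq_zero]
        exact smul_mem_Fil r n m'
  obtain ⟨φ, hφ⟩ := Module.projective_lifting_property u π hu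
  have hφ' : ∀ p, (Fil r n M).mkQ (φ p : M) = π p := fun x =>
    congrArg Subtype.val (LinearMap.congr_fun hφ x)
  obtain ⟨e'⟩ := exists_red (r ^ (n + 1)) e
  let S := LinearMap.range (LinearMap.lsmul R P (r ^ (n + 1)))
  refine ⟨P ⧸ S, inferInstance, inferInstance, k, d, e',
    S.liftQ (T.subtype ∘ₗ φ) ?_, ?_, ?_, ?_⟩
  · rintro _ ⟨p, rfl⟩
    rw [LinearMap.mem_ker]
    show T.subtype (φ (r ^ (n + 1) • p)) = 0
    rw [map_smul, map_smul]
    exact (φ p).2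
  · intro q
    induction q using Submodule.Quotient.induction_on with
    | H p =>
      rw [← Submodule.Quotient.mk_smul, Submodule.Quotient.mk_eq_zero]
      exact ⟨p, rfl⟩
  · intro q
    induction q using Submodule.Quotient.induction_on with
    | H p =>
      intro hq
      have hq : (φ p : M) ∈ Fil r n M := hq
      obtain ⟨p', rfl⟩ := hk p (by
        apply Subtype.ext
        rw [← hφ', Submodule.mkQ_apply]
        exact (Submodule.Quotient.mk_eq_zero _).2 hq)
      exact ⟨S.mkQ p', rfl⟩
  · intro m hm
    obtain ⟨p, hp⟩ := hπ ⟨(Fil r n M).mkQ m, (hkt m).2 hm⟩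
    refine ⟨S.mkQ p, ?_⟩
    show m - (φ p : M) ∈ Fil r n M
    rw [← Submodule.Quotient.mk_eq_zero, ← Submodule.mkQ_apply, map_sub, hφ', hp, sub_self]

theorem forward (hR : IsDevissageSetup R r) (hK0 : HK0 (Ideal.span {r}))
    [Module.Finite R M] (hM : ∀ j, RetQ (Ideal.span {r}) (M ⧸ Fil r j M))
    (N : ℕ) (hb : ∀ x : M, (∃ k : ℕ, r ^ k • x = 0) → r ^ N • x = 0) :
    ∃ (Minf : Type u) (_ : AddCommGroup Minf) (_ : Module R Minf),
        FinProjConstRank R Minf ∧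
        ∃ (Mn : Fin N → Type u) (_ : ∀ i, AddCommGroup (Mn i)) (_ : ∀ i, Module R (Mn i)),
          (∀ i : Fin N,
            ∃ h : Module.IsTorsionBySet R (Mn i)
                ((Ideal.span {r ^ ((i : ℕ) + 1)} : Ideal R) : Set R),
              letI := h.module
              FinProjConstRank (R ⧸ (Ideal.span {r ^ ((i : ℕ) + 1)} : Ideal R)) (Mn i)) ∧
          Nonempty (M ≃ₗ[R] (Minf × ((i : Fin N) → Mn i))) := by
  obtain ⟨P, _, _, k, d, e, φ, hφ1, hφ2⟩ := exists_inf hR hK0 hM N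
  choose Q iQ1 iQ2 kQ dQ eQ ψ hψ0 hψ1 hψ2 using fun i : Fin N => exists_piece hR hK0 hM (i : ℕ)
  refine ⟨P, inferInstance, inferInstance, constRank_of_stablyFree e, Q, iQ1, iQ2,
    fun i => ⟨(stablyFree_retQ (eQ i)).torsion, stablyFree_finProjConstRank (eQ i) _⟩, ?_⟩
  have hψ0' : ∀ (i : Fin N) (j : ℕ), (i : ℕ) < j → ∀ q : Q i, r ^ j • q = 0 := by
    intro i j hij q
    obtain ⟨l, rfl⟩ : ∃ l, j = l + ((i : ℕ) + 1) := ⟨j - (i + 1), by omega⟩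
    rw [pow_add, mul_smul, hψ0, smul_zero]
  have hψF : ∀ (i : Fin N) (j : ℕ), (i : ℕ) < j → ∀ q : Q i, ψ i q ∈ Fil r j M := by
    intro i j hij q
    exact ⟨0, by rw [← map_smul, hψ0' i j hij, map_zero, smul_zero]⟩
  let Ψ : (∀ i, Q i) →ₗ[R] M := ∑ i, ψ i ∘ₗ LinearMap.proj i
  have hΨ : ∀ y, Ψ y = ∑ i, ψ i (y i) := fun y => by simp [Ψ]
  let Φ : (P × (∀ i, Q i)) →ₗ[R] M := φ.coprod Ψ
  have hΦ : ∀ x, Φ x = φ x.1 + ∑ i, ψ i (x.2 i) := fun x => by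
    rw [← hΨ]; rfl
  have claim : ∀ l j : ℕ, j + l = N → ∀ x, Φ x ∈ Fil r j M →
      (∃ p, x.1 = r • p) ∧ ∀ i : Fin N, j ≤ i → ∃ q, x.2 i = r • q := by
    intro l
    induction l with
    | zero =>
      intro j hj x hx
      obtain rfl : j = N := by omega
      refine ⟨hφ1 _ ?_, fun i hi => by omega⟩
      rw [hΦ] at hx
      exact (Submodule.add_mem_iff_left _ (Submodule.sum_mem _ (fun i _ => hψF i _ i.2 _))).1 hx
    | succ l ih =>
      intro j hj x hx
      obtain ⟨⟨p, hp⟩, h2⟩ := ih (j + 1) (by omega) x (Fil_succ r j hx)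
      refine ⟨⟨p, hp⟩, fun i hi => ?_⟩
      rcases Nat.lt_or_ge j i with h | h
      · exact h2 i h
      obtain rfl : j = i := le_antisymm hi h
      apply hψ1
      rw [hΦ, hp, map_smul] at hx
      have hx := (Submodule.add_mem_iff_right _ (smul_mem_Fil r _ _)).1 hx
      rw [← Finset.add_sum_erase _ _ (Finset.mem_univ i)] at hx
      refine (Submodule.add_mem_iff_left _ (Submodule.sum_mem _ (fun i' hi' => ?_))).1 hx
      rcases Nat.lt_or_ge i' i with h' | h'
      · exact hψF i' _ h' _
      · have hne : (i' : ℕ) ≠ i := fun h => Finset.ne_of_mem_erase hi' (Fin.ext h)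
        obtain ⟨q, hq⟩ := h2 i' (by omega)
        rw [hq, map_smul]
        exact smul_mem_Fil r _ _
  have claim2 : ∀ l j : ℕ, j + l = N → ∀ m, ∃ x, m - Φ x ∈ Fil r j M := by
    classical
    intro l
    induction l with
    | zero =>
      intro j hj m
      obtain rfl : j = N := by omega
      obtain ⟨p, hp⟩ := hφ2 m
      exact ⟨(p, 0), by simpa [hΦ] using hp⟩
    | succ l ih =>
      intro j hj m
      obtain ⟨x, hx⟩ := ih (j + 1) (by omega) m
      obtain ⟨q, hq⟩ := hψ2 ⟨j, by omega⟩ _ hx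
      refine ⟨x + (0, Pi.single ⟨j, by omega⟩ q), ?_⟩
      have : Φ (0, Pi.single ⟨j, by omega⟩ q) = ψ ⟨j, by omega⟩ q := by
        rw [hΦ, map_zero, zero_add, Finset.sum_eq_single ⟨j, by omega⟩]
        · simp
        · intro b _ hb
          simp [Pi.single_eq_of_ne hb]
        · simp
      rw [map_add, this, ← sub_sub]
      exact hq
  have hsurj : Function.Surjective Φ := by
    refine surj_of_mod hR Φ (fun m => ?_)
    obtain ⟨x, m', h⟩ := claim2 N 0 (by omega) m
    exact ⟨x, m', by simpa using h⟩
  have hdiv : ∀ x, Φ x = 0 → ∀ j : ℕ, ∃ y, x = r ^ j • y := by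
    intro x hx j
    induction j with
    | zero => exact ⟨x, by simp⟩
    | succ j ih =>
      obtain ⟨y, rfl⟩ := ih
      rw [map_smul] at hx
      have key : (∃ p, y.1 = r • p) ∧ ∀ i : Fin N, j ≤ i → ∃ q, y.2 i = r • q := by
        rcases Nat.lt_or_ge N j with h | h
        · obtain ⟨h1, h2⟩ := claim 0 N (by omega) y ⟨0, by rw [hb _ ⟨j, hx⟩, smul_zero]⟩
          exact ⟨h1, fun i hi => by omega⟩
        · exact claim (N - j) j (by omega) y ⟨0, by rw [hx, smul_zero]⟩
      obtain ⟨⟨p, hp⟩, h2⟩ := key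
      have h3 : ∀ i : Fin N, ∃ q, r ^ j • y.2 i = r ^ (j + 1) • q := fun i => by
        rcases Nat.lt_or_ge i j with h | h
        · exact ⟨0, by rw [hψ0' i j h, smul_zero]⟩
        · obtain ⟨q, hq⟩ := h2 i h
          exact ⟨q, by rw [hq, smul_smul, ← pow_succ]⟩
      choose q hq using h3
      refine ⟨(p, q), Prod.ext ?_ (funext hq)⟩
      show r ^ j • y.1 = r ^ (j + 1) • p
      rw [hp, smul_smul, ← pow_succ]
  have hinj : Function.Injective Φ := by
    rw [← LinearMap.ker_eq_bot, LinearMap.ker_eq_bot']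
    intro x hx
    refine Prod.ext (separated_of_sf hR e _ fun n => ?_) (funext fun i => ?_)
    · obtain ⟨y, hy⟩ := hdiv x hx n
      exact ⟨y.1, congrArg Prod.fst hy⟩
    · obtain ⟨y, hy⟩ := hdiv x hx N
      have : x.2 i = r ^ N • y.2 i := congrFun (congrArg Prod.snd hy) i
      rw [this, hψ0' i N i.2]
      rfl
  exact ⟨(LinearEquiv.ofBijective Φ ⟨hinj, hsurj⟩).symm⟩

end Forward

/-- Theorem `complet_pf_3`: if moreover every finitely generated projective
`R/rR`-module is stably free, then the conditions of the structure theorem are equivalent to the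
existence of a decomposition `M ≅ M∞ ⊕ ⊕_{1 ≤ n ≤ N} Mₙ` with `M∞` finite projective of constant
rank over `R` and `Mₙ` finite projective of constant rank over `R/rⁿR`. -/
theorem devissage_structure_decomposition {R : Type u} [CommRing R] (r : R)
    (hR : IsDevissageSetup R r)
    (hK0 : ∀ (P : Type u) (_ : AddCommGroup P) (_ : Module (R ⧸ (Ideal.span {r} : Ideal R)) P),
      Module.Finite (R ⧸ (Ideal.span {r} : Ideal R)) P →
      Module.Projective (R ⧸ (Ideal.span {r} : Ideal R)) P →
      ∃ k d : ℕ, Nonempty ((P × (Fin k → R ⧸ (Ideal.span {r} : Ideal R)))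
        ≃ₗ[R ⧸ (Ideal.span {r} : Ideal R)] (Fin d → R ⧸ (Ideal.span {r} : Ideal R))))
    (M : Type u) [AddCommGroup M] [Module R M] :
    (Module.FinitePresentation R M ∧ HasFinProjMuDevissage r M ∧ BoundedRTorsion r M) ↔
    (∃ N : ℕ, 1 ≤ N ∧
      ∃ (Minf : Type u) (_ : AddCommGroup Minf) (_ : Module R Minf),
        FinProjConstRank R Minf ∧
        ∃ (Mn : Fin N → Type u) (_ : ∀ i, AddCommGroup (Mn i)) (_ : ∀ i, Module R (Mn i)),
          (∀ i : Fin N,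
            ∃ h : Module.IsTorsionBySet R (Mn i)
                ((Ideal.span {r ^ ((i : ℕ) + 1)} : Ideal R) : Set R),
              letI := h.module
              FinProjConstRank (R ⧸ (Ideal.span {r ^ ((i : ℕ) + 1)} : Ideal R)) (Mn i)) ∧
          Nonempty (M ≃ₗ[R] (Minf × ((i : Fin N) → Mn i)))) := by
  constructor
  · rintro ⟨h1, h2, N, hN, hb⟩
    exact ⟨N, hN, forward hR hK0 (retQ_of_devissage r h2) N hb⟩
  · rintro ⟨N, hN, Minf, _, _, hinf, Mn, _, _, hMn, ⟨e⟩⟩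
    refine backward r hR hK0 M N hN Minf hinf Mn (fun i => ?_) e
    obtain ⟨h, h1, h2, -⟩ := hMn i
    exact RetQ.of_finite_proj h ⟨h1, h2⟩
end

section
/- Let (R, r) be a dévissage setup, n ≥ 1, and let M be a projective R/rⁿR-module. Then for every integer 0 ≤ k < n, the submodule M[rᵏ] = {x ∈ M | rᵏ·x = 0} equals r^{n−k}M. -/
open Pointwise

universe u

/-- part of Lemma `lemma_pour_ko_1`: for a dévissage setup `(R,r)`, `n ≥ 1` and
a projective `R/rⁿR`-module `M`, one has `M[rᵏ] = r^{n-k}M` for every `0 ≤ k < n`. -/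
theorem torsionBy_eq_smul_top_of_projective {R : Type u} [CommRing R] (r : R)
    (hR : IsDevissageSetup R r) (n : ℕ) (hn : 1 ≤ n)
    (M : Type u) [AddCommGroup M] [Module R M]
    (h : Module.IsTorsionBySet R M ((Ideal.span {r ^ n} : Ideal R) : Set R))
    (hproj : letI := h.module; Module.Projective (R ⧸ (Ideal.span {r ^ n} : Ideal R)) M) :
    ∀ k : ℕ, k < n →
      Submodule.torsionBy R M (r ^ k) = (r ^ (n - k) • (⊤ : Submodule R M)) := by
  letI := h.module
  haveI : IsScalarTower R (R ⧸ (Ideal.span {r ^ n} : Ideal R)) M := h.isScalarTower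
  have hcancel : ∀ (k : ℕ) (x : R), r ^ k * x = 0 → x = 0 := by
    intro k
    induction k with
    | zero => intro x hx; simpa using hx
    | succ k ih =>
      intro x hx
      apply ih
      apply hR.torsionFree
      rw [← mul_assoc, ← pow_succ']
      exact hx
  intro k hk
  ext x
  rw [Submodule.mem_torsionBy_iff, Submodule.mem_smul_pointwise_iff_exists]
  constructor
  · intro hx
    obtain ⟨s, hs⟩ := (Module.projective_def (R := R ⧸ (Ideal.span {r ^ n} : Ideal R))
      (P := M)).mp hproj
    have hx' : (Ideal.Quotient.mk (Ideal.span {r ^ n} : Ideal R) (r ^ k)) • x = 0 := hx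
    have hc : ∀ m : M, ∃ b : R, s x m =
        Ideal.Quotient.mk (Ideal.span {r ^ n} : Ideal R) (r ^ (n - k) * b) := by
      intro m
      obtain ⟨a, ha⟩ := Ideal.Quotient.mk_surjective (s x m)
      have h1 : Ideal.Quotient.mk (Ideal.span {r ^ n} : Ideal R) (r ^ k) * s x m = 0 := by
        have := congrArg (fun f => f m) (congrArg s hx')
        simpa using this
      rw [← ha, ← map_mul, Ideal.Quotient.eq_zero_iff_mem, Ideal.mem_span_singleton] at h1
      obtain ⟨b, hb⟩ := h1
      refine ⟨b, ?_⟩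
      rw [← ha]
      congr 1
      apply sub_eq_zero.mp
      apply hcancel k
      have hnk : r ^ n = r ^ k * r ^ (n - k) := by
        rw [← pow_add]; congr 1; omega
      rw [mul_sub, hb, hnk]
      ring
    choose c hc using hc
    refine ⟨∑ m ∈ (s x).support, c m • m, Submodule.mem_top, ?_⟩
    have h2 := hs x
    rw [Finsupp.linearCombination_apply, Finsupp.sum] at h2
    refine Eq.trans ?_ h2
    rw [Finset.smul_sum]
    refine Finset.sum_congr rfl fun m _ => ?_
    rw [hc m, smul_smul]
    rfl
  · rintro ⟨y, -, rfl⟩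
    rw [smul_smul, ← pow_add, show k + (n - k) = n by omega]
    have h3 := (Module.isTorsionBySet_span_singleton_iff (r ^ n)).mp h
    exact @h3 y
end
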